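/- arXiv:1002.0823 — 4 statements merged into one kernel-verified Lean document; each statement's English description precedes it below -/
import Mathlib

section
/- Fix a nonempty open arc I of the unit circle. Let b, c : ℤ → ℂ be bounded two-sided sequences, both reflectionless on I. If there is an integer k such that b_n = c_n for all n ≤ k, then b = c; likewise, if there is an integer k such that b_n = c_n for all n ≥ k, then b = c. In other words, a bounded sequence reflectionless on I is uniquely determined by its restriction to any left half-line {n ≤ k} (or any right half-line {n ≥ k}) of ℤ. -/
open Filter Metric Set MeasureTheory

/-- `b : ℤ → ℂ` is a right limit of `a : ℕ → ℂ`. -/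
def IsRightLimit (a : ℕ → ℂ) (b : ℤ → ℂ) : Prop :=
  ∃ n : ℕ → ℕ, StrictMono n ∧
    ∀ k : ℤ, Tendsto (fun j => a (k + n j).toNat) atTop (nhds (b k))

/-- `f_+` for a two-sided sequence. -/
noncomputable def fPlus (b : ℤ → ℂ) (z : ℂ) : ℂ := ∑' n : ℕ, b n * z ^ n

/-- `f_-` for a two-sided sequence. -/
noncomputable def fMinus (b : ℤ → ℂ) (z : ℂ) : ℂ :=
  ∑' n : ℕ, b (-(n : ℤ) - 1) * z ^ (-(n : ℤ) - 1)

/-- The open arc `{e^{iθ} : α < θ < β}` of the unit circle. -/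
def arc (α β : ℝ) : Set ℂ := {z | ∃ θ ∈ Set.Ioo α β, z = Complex.exp (θ * Complex.I)}

/-- The two-sided sequence `b` is reflectionless on the arc `I`. -/
def Reflectionless (b : ℤ → ℂ) (I : Set ℂ) : Prop :=
  ∃ g : ℂ → ℂ,
    DifferentiableOn ℂ g ((Metric.sphere (0 : ℂ) 1 \ I)ᶜ) ∧
    (∀ z ∈ Metric.ball (0 : ℂ) 1, g z = fPlus b z) ∧
    (∀ z : ℂ, 1 < ‖z‖ → g z = - fMinus b z)

/-- `f` has a strong natural boundary on the unit circle. -/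
def StrongNaturalBoundary (f : ℂ → ℂ) : Prop :=
  ∀ α β : ℝ, α < β →
    ¬ ∃ M : ℝ, ∀ r : ℝ, 0 < r → r < 1 →
      (∫ θ in α..β, ‖f (r * Complex.exp (θ * Complex.I))‖) / (2 * Real.pi) ≤ M

/-- `f` has a (classical) natural boundary on the unit circle. -/
def NaturalBoundary (f : ℂ → ℂ) : Prop :=
  ¬ ∃ z₀ : ℂ, ‖z₀‖ = 1 ∧ ∃ δ > (0 : ℝ), ∃ g : ℂ → ℂ,
    DifferentiableOn ℂ g (Metric.ball (0 : ℂ) 1 ∪ Metric.ball z₀ δ) ∧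
    ∀ z ∈ Metric.ball (0 : ℂ) 1, g z = f z

theorem aux_summable (a : ℕ → ℂ) (A : ℝ) (ha : ∀ n, ‖a n‖ ≤ A) (z : ℂ) (hz : ‖z‖ < 1) :
    Summable (fun n => a n * z ^ n) := by
  refine Summable.of_norm_bounded (g := fun n => A * ‖z‖ ^ n)
    ((summable_geometric_of_lt_one (norm_nonneg _) hz).mul_left A) (fun n => ?_)
  rw [norm_mul, norm_pow]
  exact mul_le_mul_of_nonneg_right (ha n) (by positivity)

theorem aux_fps (a : ℕ → ℂ) (A : ℝ) (ha : ∀ n, ‖a n‖ ≤ A) :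
    HasFPowerSeriesOnBall (fun z => ∑' n, a n * z ^ n)
      (FormalMultilinearSeries.ofScalars ℂ a) 0 1 := by
  refine ⟨?_, by simp, ?_⟩
  · have := (FormalMultilinearSeries.ofScalars ℂ a : FormalMultilinearSeries ℂ ℂ ℂ).le_radius_of_bound
      (r := 1) A (fun n => by
        simpa [FormalMultilinearSeries.ofScalars_norm] using ha n)
    simpa using this
  · intro y hy
    have hy' : ‖y‖ < 1 := by
      simpa [Metric.mem_eball, edist_zero_right, enorm_eq_nnnorm, ← NNReal.coe_lt_coe] using hy
    have := (aux_summable a A ha y hy').hasSum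
    simpa [FormalMultilinearSeries.ofScalars_apply_eq, mul_comm] using this

theorem aux_zero (a : ℕ → ℂ) (A : ℝ) (ha : ∀ n, ‖a n‖ ≤ A) (w : ℂ) (hw : ‖w‖ < 1)
    (h : ∀ᶠ z in nhds w, ∑' n, a n * z ^ n = 0) (n : ℕ) : a n = 0 := by
  have hf := aux_fps a A ha
  have hball : Metric.eball (0 : ℂ) 1 = Metric.ball 0 1 := by
    simpa using Metric.eball_ofReal (x := (0 : ℂ)) (ε := 1)
  have han : AnalyticOnNhd ℂ (fun z => ∑' n, a n * z ^ n) (Metric.ball 0 1) := by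
    rw [← hball]; exact hf.analyticOnNhd
  have hz := han.eqOn_zero_of_preconnected_of_eventuallyEq_zero
    (convex_ball (0 : ℂ) 1).isPreconnected (z₀ := w) (by simpa using hw) h
  have h0 : (fun z => ∑' n, a n * z ^ n) =ᶠ[nhds 0] 0 :=
    Filter.eventuallyEq_of_mem (Metric.ball_mem_nhds 0 one_pos) hz
  have hp := (hf.hasFPowerSeriesAt.congr h0).eq_zero
  have := congrArg (fun p => p.coeff n) hp
  simp only [FormalMultilinearSeries.coeff_ofScalars] at this
  rw [this]
  rfl

theorem aux_arc (α β θ : ℝ) (h : θ ∈ Set.Ioo α β) :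
    ∃ δ : ℝ, 0 < δ ∧ δ < 1 ∧ Metric.ball (Complex.exp (θ * Complex.I)) δ ⊆
      (Metric.sphere (0 : ℂ) 1 \ arc α β)ᶜ := by
  set p := Complex.exp (θ * Complex.I) with hp
  have hp0 : p ≠ 0 := Complex.exp_ne_zero _
  have hp1 : ‖p‖ = 1 := Complex.norm_exp_ofReal_mul_I θ
  have hc : ContinuousAt (fun z : ℂ => θ + Complex.arg (z / p)) p := by
    refine continuousAt_const.add (ContinuousAt.comp (f := fun z : ℂ => z / p) (g := Complex.arg) ?_ ?_)
    · apply Complex.continuousAt_arg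
      simp [div_self hp0]
    · exact continuousAt_id.div_const _
  have hm : ∀ᶠ z in nhds p, θ + Complex.arg (z / p) ∈ Set.Ioo α β := by
    apply hc.eventually_mem
    simp only [div_self hp0, Complex.arg_one, add_zero]
    exact Ioo_mem_nhds h.1 h.2
  obtain ⟨ε, hε, hb⟩ := Metric.eventually_nhds_iff_ball.1 hm
  refine ⟨min ε (1 / 2), by positivity, by
    have := min_le_right ε (1 / 2 : ℝ); linarith, ?_⟩
  rintro z hz ⟨hz1, hz2⟩
  apply hz2
  refine ⟨_, hb z (Metric.ball_subset_ball (min_le_left _ _) hz), ?_⟩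
  have hz1' : ‖z‖ = 1 := by simpa using hz1
  have : ‖z / p‖ = 1 := by rw [norm_div, hz1', hp1, div_one]
  have h2 := Complex.norm_mul_exp_arg_mul_I (z / p)
  rw [this] at h2
  push_cast
  rw [add_mul, Complex.exp_add, ← hp]
  simp only [Complex.ofReal_one, one_mul] at h2
  rw [h2]
  field_simp

theorem aux_minus_eq (b : ℤ → ℂ) (z : ℂ) (hz : z ≠ 0) :
    fMinus b z = z⁻¹ * ∑' n : ℕ, b (-(n : ℤ) - 1) * z⁻¹ ^ n := by
  unfold fMinus
  rw [← tsum_mul_left]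
  congr 1; ext n
  rw [zpow_sub₀ hz, zpow_neg]
  simp [div_eq_mul_inv]
  ring

/-- Difference of reflectionless sequences. -/
theorem aux_sub (b c : ℤ → ℂ) (A : ℝ) (hb : ∀ n : ℤ, ‖b n‖ ≤ A) (hc : ∀ n : ℤ, ‖c n‖ ≤ A)
    (I : Set ℂ) (hbr : Reflectionless b I) (hcr : Reflectionless c I) :
    Reflectionless (fun n => b n - c n) I := by
  obtain ⟨g, g1, g2, g3⟩ := hbr
  obtain ⟨h, h1, h2, h3⟩ := hcr
  refine ⟨fun z => g z - h z, g1.sub h1, fun z hz => ?_, fun z hz => ?_⟩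
  · have hz' : ‖z‖ < 1 := by simpa using hz
    simp only [g2 z hz, h2 z hz, fPlus]
    rw [← (aux_summable (fun n : ℕ => b n) A (fun n => hb n) z hz').tsum_sub
      (aux_summable (fun n : ℕ => c n) A (fun n => hc n) z hz')]
    simp only [sub_mul]
  · have hz0 : z ≠ 0 := by rintro rfl; norm_num at hz
    have hz' : ‖z⁻¹‖ < 1 := by rw [norm_inv]; exact inv_lt_one_of_one_lt₀ hz
    simp only [g3 z hz, h3 z hz, aux_minus_eq _ z hz0, sub_mul]
    rw [(aux_summable (fun n : ℕ => b (-(n : ℤ) - 1)) A (fun n => hb _) _ hz').tsum_sub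
      (aux_summable (fun n : ℕ => c (-(n : ℤ) - 1)) A (fun n => hc _) _ hz')]
    ring

theorem aux_points (θ δ : ℝ) (h0 : 0 < δ) (h1 : δ < 1) :
    (∃ z ∈ Metric.ball (Complex.exp (θ * Complex.I)) δ, ‖z‖ < 1) ∧
    (∃ z ∈ Metric.ball (Complex.exp (θ * Complex.I)) δ, 1 < ‖z‖) := by
  have hp1 : ‖Complex.exp (θ * Complex.I)‖ = 1 := Complex.norm_exp_ofReal_mul_I θ
  set p := Complex.exp (θ * Complex.I)
  refine ⟨⟨((1 - δ / 2 : ℝ) : ℂ) * p, ?_, ?_⟩, ⟨((1 + δ / 2 : ℝ) : ℂ) * p, ?_, ?_⟩⟩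
  · rw [mem_ball_iff_norm]
    have : ((1 - δ / 2 : ℝ) : ℂ) * p - p = ((- (δ / 2) : ℝ) : ℂ) * p := by push_cast; ring
    rw [this, norm_mul, hp1, Complex.norm_real, Real.norm_eq_abs, abs_neg, abs_of_pos (by linarith)]
    linarith
  · rw [norm_mul, hp1, Complex.norm_real, Real.norm_eq_abs, abs_of_pos (by linarith)]
    linarith
  · rw [mem_ball_iff_norm]
    have : ((1 + δ / 2 : ℝ) : ℂ) * p - p = (((δ / 2) : ℝ) : ℂ) * p := by push_cast; ring
    rw [this, norm_mul, hp1, Complex.norm_real, Real.norm_eq_abs, abs_of_pos (by linarith)]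
    linarith
  · rw [norm_mul, hp1, Complex.norm_real, Real.norm_eq_abs, abs_of_pos (by linarith)]
    linarith

/-- Local identity theorem on a ball. -/
theorem aux_ident (f g : ℂ → ℂ) (p : ℂ) (δ : ℝ) (hf : DifferentiableOn ℂ f (Metric.ball p δ))
    (hg : DifferentiableOn ℂ g (Metric.ball p δ)) (z : ℂ) (hz : z ∈ Metric.ball p δ)
    (h : f =ᶠ[nhds z] g) : Set.EqOn f g (Metric.ball p δ) :=
  (hf.analyticOnNhd Metric.isOpen_ball).eqOn_of_preconnected_of_eventuallyEq
    (hg.analyticOnNhd Metric.isOpen_ball) (convex_ball p δ).isPreconnected hz h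

theorem aux_left (α β : ℝ) (hαβ : α < β) (d : ℤ → ℂ) (A : ℝ) (hd : ∀ n : ℤ, ‖d n‖ ≤ A)
    (hr : Reflectionless d (arc α β)) (N : ℕ) (hN : ∀ n : ℤ, n < -(N : ℤ) → d n = 0) (n : ℤ) :
    d n = 0 := by
  obtain ⟨g, g1, g2, g3⟩ := hr
  obtain ⟨δ, h0, h1, hsub⟩ := aux_arc α β ((α + β) / 2) ⟨by linarith, by linarith⟩
  obtain ⟨⟨z₁, hz₁, hz₁'⟩, ⟨z₂, hz₂, hz₂'⟩⟩ := aux_points ((α + β) / 2) δ h0 h1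
  set p := Complex.exp (((α + β) / 2 : ℝ) * Complex.I)
  have key := aux_ident (fun z => z ^ N * g z)
    (fun z => - ∑ m ∈ Finset.range N, d ((m : ℤ) - N) * z ^ m) p δ
    (DifferentiableOn.mul (by fun_prop) (g1.mono hsub)) (by fun_prop) z₂ hz₂ (by
      filter_upwards [(isOpen_lt continuous_const continuous_norm).mem_nhds hz₂'] with z hz
      have hz : 1 < ‖z‖ := hz
      have hz0 : z ≠ 0 := by rintro rfl; norm_num at hz
      rw [g3 z hz, fMinus, tsum_eq_sum (s := Finset.range N), ← Finset.sum_range_reflect,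
        mul_neg, Finset.mul_sum]
      · congr 1
        apply Finset.sum_congr rfl
        intro m hm
        have hm := Finset.mem_range.1 hm
        have e : ((N - 1 - m : ℕ) : ℤ) = N - 1 - m := by omega
        rw [e]
        have e2 : -((N : ℤ) - 1 - m) - 1 = m - N := by ring
        rw [e2, zpow_sub₀ hz0]
        have : z ^ N ≠ 0 := pow_ne_zero _ hz0
        simp only [zpow_natCast]
        field_simp
      · intro m hm
        have hm : N ≤ m := by simpa using hm
        rw [hN _ (by omega), zero_mul])
  have hz := aux_zero (fun m : ℕ => d ((m : ℤ) - N)) A (fun _ => hd _) z₁ hz₁' (by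
    filter_upwards [(isOpen_lt continuous_norm continuous_const).mem_nhds hz₁',
      Metric.isOpen_ball.mem_nhds hz₁] with z hz hzb
    have hz : ‖z‖ < 1 := hz
    have hk := key hzb
    simp only at hk
    rw [g2 z (by simpa using hz), fPlus] at hk
    rw [← (aux_summable (fun m : ℕ => d ((m : ℤ) - N)) A (fun _ => hd _) z hz).sum_add_tsum_nat_add N]
    have : ∑' i : ℕ, d (((i + N : ℕ) : ℤ) - N) * z ^ (i + N) = z ^ N * ∑' n : ℕ, d n * z ^ n := by
      rw [← tsum_mul_left]
      congr 1; ext i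
      push_cast
      rw [add_sub_cancel_right, pow_add]; ring
    rw [this, hk]; ring)
  by_cases h : n < -(N : ℤ)
  · exact hN n h
  · have := hz (n + N).toNat
    rwa [Int.toNat_of_nonneg (by omega), add_sub_cancel_right] at this

theorem aux_right (α β : ℝ) (hαβ : α < β) (d : ℤ → ℂ) (A : ℝ) (hd : ∀ n : ℤ, ‖d n‖ ≤ A)
    (hr : Reflectionless d (arc α β)) (N : ℕ) (hN : ∀ n : ℤ, (N : ℤ) < n → d n = 0) (n : ℤ) :
    d n = 0 := by
  obtain ⟨g, g1, g2, g3⟩ := hr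
  obtain ⟨δ, h0, h1, hsub⟩ := aux_arc α β ((α + β) / 2) ⟨by linarith, by linarith⟩
  obtain ⟨⟨z₁, hz₁, hz₁'⟩, ⟨z₂, hz₂, hz₂'⟩⟩ := aux_points ((α + β) / 2) δ h0 h1
  set p := Complex.exp (((α + β) / 2 : ℝ) * Complex.I)
  have key := aux_ident g
    (fun z => ∑ m ∈ Finset.range (N + 1), d (m : ℤ) * z ^ m) p δ
    (g1.mono hsub) (by fun_prop) z₁ hz₁ (by
      filter_upwards [(isOpen_lt continuous_norm continuous_const).mem_nhds hz₁'] with z hz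
      have hz : ‖z‖ < 1 := hz
      rw [g2 z (by simpa using hz), fPlus, tsum_eq_sum (s := Finset.range (N + 1))]
      intro m hm
      have hm : N + 1 ≤ m := by simpa using hm
      rw [hN _ (by omega), zero_mul])
  have hz20 : z₂ ≠ 0 := by rintro rfl; norm_num at hz₂'
  have hw : ‖z₂⁻¹‖ < 1 := by rw [norm_inv]; exact inv_lt_one_of_one_lt₀ hz₂'
  have hcont : ContinuousAt (fun w : ℂ => w⁻¹) z₂⁻¹ := continuousAt_inv₀ (inv_ne_zero hz20)
  have hz := aux_zero (fun m : ℕ => d ((N : ℤ) - m)) A (fun _ => hd _) z₂⁻¹ hw (by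
    have e1 : ∀ᶠ w in nhds z₂⁻¹, w⁻¹ ∈ Metric.ball p δ :=
      hcont.eventually_mem (by rw [inv_inv]; exact Metric.isOpen_ball.mem_nhds hz₂)
    filter_upwards [(isOpen_lt continuous_norm continuous_const).mem_nhds hw, e1,
      isOpen_ne.mem_nhds (inv_ne_zero hz20)] with w hw hwb hw0
    have hw : ‖w‖ < 1 := hw
    have hw0 : w ≠ 0 := hw0
    have hk := key hwb
    have hw1 : 1 < ‖w⁻¹‖ := by
      rw [norm_inv]; exact (one_lt_inv₀ (norm_pos_iff.2 hw0)).2 hw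
    simp only at hk
    rw [g3 _ hw1, aux_minus_eq _ _ (inv_ne_zero hw0), inv_inv] at hk
    rw [← (aux_summable (fun m : ℕ => d ((N : ℤ) - m)) A (fun _ => hd _) w hw).sum_add_tsum_nat_add
      (N + 1)]
    have t1 : ∑' i : ℕ, d ((N : ℤ) - ((i + (N + 1) : ℕ) : ℤ)) * w ^ (i + (N + 1)) =
        w ^ N * (w * ∑' n : ℕ, d (-(n : ℤ) - 1) * w ^ n) := by
      rw [← tsum_mul_left, ← tsum_mul_left]
      congr 1; ext i
      have : (N : ℤ) - ((i + (N + 1) : ℕ) : ℤ) = -(i : ℤ) - 1 := by push_cast; ring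
      rw [this]; ring
    have t2 : ∑ i ∈ Finset.range (N + 1), d ((N : ℤ) - i) * w ^ i =
        w ^ N * ∑ m ∈ Finset.range (N + 1), d (m : ℤ) * w⁻¹ ^ m := by
      rw [← Finset.sum_range_reflect, Finset.mul_sum]
      apply Finset.sum_congr rfl
      intro m hm
      have hm := Finset.mem_range.1 hm
      have e : ((N + 1 - 1 - m : ℕ) : ℤ) = N - m := by omega
      have e2 : N + 1 - 1 - m = N - m := by omega
      rw [e, e2, sub_sub_cancel, pow_sub₀ w hw0 (by omega), inv_pow]
      ring
    rw [t1, t2, ← hk]; ring)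
  by_cases h : (N : ℤ) < n
  · exact hN n h
  · have := hz (N - n).toNat
    rwa [Int.toNat_of_nonneg (by omega), sub_sub_cancel] at this

theorem stmt9 (α β : ℝ) (hαβ : α < β)
    (b c : ℤ → ℂ) (A : ℝ) (hb : ∀ n : ℤ, ‖b n‖ ≤ A) (hc : ∀ n : ℤ, ‖c n‖ ≤ A)
    (hbr : Reflectionless b (arc α β)) (hcr : Reflectionless c (arc α β)) :
    (∀ k : ℤ, (∀ n : ℤ, n ≤ k → b n = c n) → b = c) ∧
    (∀ k : ℤ, (∀ n : ℤ, k ≤ n → b n = c n) → b = c) := by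
  have hr := aux_sub b c A hb hc _ hbr hcr
  have hd : ∀ n : ℤ, ‖b n - c n‖ ≤ A + A := fun n =>
    (norm_sub_le _ _).trans (add_le_add (hb n) (hc n))
  refine ⟨fun k hk => ?_, fun k hk => ?_⟩
  · ext n
    exact sub_eq_zero.1 (aux_left α β hαβ _ (A + A) hd hr k.natAbs
      (fun m hm => sub_eq_zero.2 (hk m (by omega))) n)
  · ext n
    exact sub_eq_zero.1 (aux_right α β hαβ _ (A + A) hd hr k.natAbs
      (fun m hm => sub_eq_zero.2 (hk m (by omega))) n)
end

section
/- Let (a_n)_{n≥0} be a bounded sequence of complex numbers admitting two right limits b, c : ℤ → ℂ such that b_0 ≠ c_0 and either: there is k > 0 with b_j = c_j for all j ≥ k, or there is k < 0 with b_j = c_j for all j ≤ k. Then f(z) = Σ_{n=0}^∞ a_n z^n has a natural boundary on ∂𝔻. -/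
open Filter Metric Set MeasureTheory

lemma coeff_zero_aux (s : ℕ → ℂ) (C : ℝ) (hs : ∀ n, ‖s n‖ ≤ C) (w : ℂ) (hw : ‖w‖ < 1)
    (h : ∀ᶠ z in nhds w, ∑' n : ℕ, s n * z ^ n = 0) : ∀ n, s n = 0 := by
  set p := FormalMultilinearSeries.ofScalars ℂ s with hp
  have hr : (1 : NNReal) ≤ p.radius := by
    apply p.le_radius_of_bound C
    intro n
    simpa [hp, FormalMultilinearSeries.ofScalars_norm] using hs n
  have hr' : (1 : ENNReal) ≤ p.radius := by simpa using hr
  have h1 : HasFPowerSeriesOnBall p.sum p 0 1 :=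
    (p.hasFPowerSeriesOnBall (lt_of_lt_of_le one_pos hr')).mono one_pos hr'
  have hsum : ∀ z, p.sum z = ∑' n : ℕ, s n * z ^ n := by
    intro z
    have := FormalMultilinearSeries.ofScalars_sum_eq s z
    simpa [FormalMultilinearSeries.ofScalarsSum, hp, smul_eq_mul] using this
  have h2 := h1.analyticOnNhd
  have h3 : EqOn p.sum 0 (Metric.eball (0:ℂ) 1) := by
    apply h2.eqOn_zero_of_preconnected_of_eventuallyEq_zero (z₀ := w)
    · have : Metric.eball (0:ℂ) 1 = Metric.ball 0 1 := by
        simpa using Metric.eball_ofReal (x := (0:ℂ)) (ε := 1)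
      rw [this]
      exact (convex_ball _ _).isPreconnected
    · simp only [Metric.mem_eball, edist_zero_right]
      rw [← ofReal_norm]
      exact (ENNReal.ofReal_lt_one).2 hw
    · filter_upwards [h] with z hz
      simp [hsum, hz]
  have h4 : p = 0 := h1.hasFPowerSeriesAt.eq_zero_of_eventually
    (h3.eventuallyEq_of_mem (Metric.eball_mem_nhds _ one_pos))
  have h5 : s = 0 := (FormalMultilinearSeries.ofScalars_series_eq_zero (E := ℂ)).1 h4
  intro n; simp [h5]

lemma vitali_aux (h : ℕ → ℂ → ℂ) (z₀ : ℂ) (ρ : ℝ) (hρ : 0 < ρ) (M : ℝ) (L : ℂ → ℂ)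
    (hd : ∀ j, DifferentiableOn ℂ (h j) (closedBall z₀ ρ))
    (hM : ∀ j, ∀ z ∈ sphere z₀ ρ, ‖h j z‖ ≤ M)
    (hL : ∀ z ∈ sphere z₀ ρ, Tendsto (fun j => h j z) atTop (nhds (L z))) :
    ∃ F : ℂ → ℂ, AnalyticOnNhd ℂ F (ball z₀ ρ) ∧
      ∀ z ∈ ball z₀ ρ, Tendsto (fun j => h j z) atTop (nhds (F z)) := by
  have hmem : ∀ θ : ℝ, circleMap z₀ ρ θ ∈ sphere z₀ ρ := circleMap_mem_sphere z₀ hρ.le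
  have hcont : ∀ j, Continuous (fun θ => h j (circleMap z₀ ρ θ)) := fun j =>
    (hd j).continuousOn.comp_continuous (continuous_circleMap _ _)
      (fun θ => sphere_subset_closedBall (hmem θ))
  have hmeas : AEStronglyMeasurable (fun θ => L (circleMap z₀ ρ θ)) (volume : Measure ℝ) :=
    aestronglyMeasurable_of_tendsto_ae atTop (fun j => (hcont j).aestronglyMeasurable)
      (Eventually.of_forall fun θ => hL _ (hmem θ))
  have hLM : ∀ θ, ‖L (circleMap z₀ ρ θ)‖ ≤ M := fun θ =>
    le_of_tendsto (hL _ (hmem θ)).norm (Eventually.of_forall fun j => hM j _ (hmem θ))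
  have hint : CircleIntegrable L z₀ ρ := by
    rw [circleIntegrable_def]
    refine IntervalIntegrable.mono_fun' (g := fun _ => M) (by simp) hmeas.restrict ?_
    exact Eventually.of_forall hLM
  lift ρ to NNReal using hρ.le
  have hps := hasFPowerSeriesOn_cauchy_integral hint (by exact_mod_cast hρ)
  refine ⟨fun w => (2 * Real.pi * Complex.I : ℂ)⁻¹ • ∮ ζ in C(z₀, ρ), (ζ - w)⁻¹ • L ζ, ?_, ?_⟩
  · have := hps.analyticOnNhd
    rwa [Metric.eball_coe] at this
  · intro z hz
    have hk : ∀ j, (2 * Real.pi * Complex.I : ℂ)⁻¹ • (∮ ζ in C(z₀, ρ), (ζ - z)⁻¹ • h j ζ) = h j z := by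
      intro j
      apply Complex.two_pi_I_inv_smul_circleIntegral_sub_inv_smul_of_differentiable_on_off_countable
        countable_empty hz (hd j).continuousOn
      intro x hx
      exact (hd j).differentiableAt (closedBall_mem_nhds_of_mem hx.1)
    simp only [← hk]
    apply Tendsto.const_smul
    unfold circleIntegral
    have hci := continuous_circleMap_inv hz
    have hcd : Continuous (deriv (circleMap z₀ ρ)) := by
      have : deriv (circleMap z₀ ρ) = fun θ => circleMap 0 ρ θ * Complex.I :=
        funext fun θ => deriv_circleMap z₀ ρ θ
      rw [this]
      exact (continuous_circleMap _ _).mul continuous_const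
    refine intervalIntegral.tendsto_integral_filter_of_dominated_convergence
      (fun θ => ‖deriv (circleMap z₀ ρ) θ‖ * (‖(circleMap z₀ ρ θ - z)⁻¹‖ * M)) ?_ ?_ ?_ ?_
    · exact Eventually.of_forall fun j => (hcd.smul (hci.smul (hcont j))).aestronglyMeasurable
    · refine Eventually.of_forall fun j => Eventually.of_forall fun θ _ => ?_
      rw [norm_smul, norm_smul]
      gcongr
      exact hM j _ (hmem θ)
    · exact (hcd.norm.mul (hci.norm.mul continuous_const)).intervalIntegrable _ _
    · refine Eventually.of_forall fun θ _ => ?_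
      exact ((hL _ (hmem θ)).const_smul _).const_smul _

/-- The shifted tails `z ↦ ∑ a (n + N) z ^ n`, continued through `g`. -/
noncomputable def tailFn (a : ℕ → ℂ) (g : ℂ → ℂ) (N : ℕ) (z : ℂ) : ℂ :=
  z⁻¹ ^ N * g z - z⁻¹ * ∑ m ∈ Finset.range N, a (N - 1 - m) * z⁻¹ ^ m

lemma summable_aux (a : ℕ → ℂ) (C : ℝ) (hC : ∀ n, ‖a n‖ ≤ C) (z : ℂ) (hz : ‖z‖ < 1) :
    Summable (fun n => a n * z ^ n) := by
  refine Summable.of_norm_bounded ((summable_geometric_of_lt_one (norm_nonneg z) hz).mul_left C) ?_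
  intro n
  rw [norm_mul, norm_pow]
  gcongr
  exact hC n

lemma norm_tsum_aux (a : ℕ → ℂ) (C : ℝ) (hC : ∀ n, ‖a n‖ ≤ C) (z : ℂ) (hz : ‖z‖ < 1) :
    ‖∑' n, a n * z ^ n‖ ≤ C * (1 - ‖z‖)⁻¹ := by
  refine tsum_of_norm_bounded ((hasSum_geometric_of_lt_one (norm_nonneg z) hz).mul_left C) ?_
  intro n
  rw [norm_mul, norm_pow]
  gcongr
  exact hC n

lemma tailFn_inside (a : ℕ → ℂ) (C : ℝ) (hC : ∀ n, ‖a n‖ ≤ C) (g : ℂ → ℂ) (N : ℕ) (z : ℂ)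
    (hz : ‖z‖ < 1) (hz0 : z ≠ 0) (hg : g z = ∑' n : ℕ, a n * z ^ n) :
    tailFn a g N z = ∑' n : ℕ, a (n + N) * z ^ n := by
  have h1 := (summable_aux a C hC z hz).sum_add_tsum_nat_add N
  have h2 : ∑' n : ℕ, a (n + N) * z ^ (n + N) = z ^ N * ∑' n : ℕ, a (n + N) * z ^ n := by
    rw [← tsum_mul_left]
    exact tsum_congr fun n => by ring
  have h3 : z⁻¹ ^ N * ∑ i ∈ Finset.range N, a i * z ^ i
      = z⁻¹ * ∑ m ∈ Finset.range N, a (N - 1 - m) * z⁻¹ ^ m := by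
    rw [← Finset.sum_range_reflect, Finset.mul_sum, Finset.mul_sum]
    refine Finset.sum_congr rfl fun m hm => ?_
    have hm' : m < N := Finset.mem_range.1 hm
    obtain ⟨l, rfl⟩ : ∃ l, N = l + 1 + m := ⟨N - 1 - m, by omega⟩
    have : l + 1 + m - 1 - m = l := by omega
    rw [this]
    have : z⁻¹ ^ l * z ^ l = 1 := by rw [← mul_pow, inv_mul_cancel₀ hz0, one_pow]
    linear_combination (z⁻¹ * a l * z⁻¹ ^ m) * this
  have h4 : z⁻¹ ^ N * z ^ N = 1 := by rw [← mul_pow, inv_mul_cancel₀ hz0, one_pow]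
  unfold tailFn
  rw [hg, ← h1, h2, mul_add, h3, ← mul_assoc, h4]
  ring

lemma tailFn_bound (a : ℕ → ℂ) (C : ℝ) (hC : ∀ n, ‖a n‖ ≤ C) (g : ℂ → ℂ) (N : ℕ) (z : ℂ)
    (hz0 : z ≠ 0) (hz1 : ‖z‖ ≠ 1) (hz2 : ‖z‖ ≤ 2)
    (hg : ‖z‖ < 1 → g z = ∑' n : ℕ, a n * z ^ n) (G : ℝ) (hG : ‖g z‖ ≤ G) :
    ‖tailFn a g N z‖ * |‖z‖ - 1| ≤ G + C := by
  have hC0 : 0 ≤ C := (norm_nonneg _).trans (hC 0)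
  have hG0 : 0 ≤ G := (norm_nonneg _).trans hG
  rcases lt_or_gt_of_ne hz1 with h | h
  · rw [tailFn_inside a C hC g N z h hz0 (hg h), abs_of_neg (by linarith)]
    have := norm_tsum_aux (fun n => a (n + N)) C (fun n => hC _) z h
    have hp : 0 < 1 - ‖z‖ := by linarith
    calc _ ≤ C * (1 - ‖z‖)⁻¹ * (1 - ‖z‖) := by
            rw [neg_sub]; gcongr
      _ = C := by field_simp
      _ ≤ _ := by linarith
  · rw [abs_of_pos (by linarith)]
    have hw : ‖z⁻¹‖ < 1 := by rw [norm_inv]; exact inv_lt_one_of_one_lt₀ h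
    have h1 : ‖z⁻¹ ^ N * g z‖ ≤ G := by
      rw [norm_mul, norm_pow]
      calc _ ≤ 1 * G := by
            gcongr
            exact pow_le_one₀ (norm_nonneg _) hw.le
        _ = G := one_mul _
    have h2 : ‖∑ m ∈ Finset.range N, a (N - 1 - m) * z⁻¹ ^ m‖ ≤ C * (1 - ‖z⁻¹‖)⁻¹ := by
      refine (norm_sum_le _ _).trans ?_
      calc _ ≤ ∑ m ∈ Finset.range N, C * ‖z⁻¹‖ ^ m := by
            refine Finset.sum_le_sum fun m _ => ?_
            rw [norm_mul, norm_pow]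
            gcongr
            exact hC _
        _ ≤ _ := by
            rw [← Finset.mul_sum]
            gcongr
            rw [← tsum_geometric_of_lt_one (norm_nonneg _) hw]
            exact (summable_geometric_of_lt_one (norm_nonneg _) hw).sum_le_tsum _
              (fun i _ => by positivity)
    have hp : 0 < ‖z‖ - 1 := by linarith
    have h3 : ‖z⁻¹‖ * (C * (1 - ‖z⁻¹‖)⁻¹) * (‖z‖ - 1) = C := by
      rw [norm_inv]
      have : ‖z‖ ≠ 0 := by positivity
      have : (1 - ‖z‖⁻¹) = (‖z‖ - 1) / ‖z‖ := by field_simp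
      rw [this]
      field_simp
    calc _ ≤ (G + ‖z⁻¹‖ * (C * (1 - ‖z⁻¹‖)⁻¹)) * (‖z‖ - 1) := by
            gcongr
            refine (norm_sub_le _ _).trans ?_
            gcongr
            rw [norm_mul]
            gcongr
      _ = G * (‖z‖ - 1) + C := by rw [add_mul, h3]
      _ ≤ _ := by nlinarith

lemma tailFn_tendsto_inside (a : ℕ → ℂ) (C : ℝ) (hC : ∀ n, ‖a n‖ ≤ C) (g : ℂ → ℂ) (N : ℕ → ℕ)
    (b : ℤ → ℂ) (hb : ∀ k : ℤ, Tendsto (fun j => a (k + N j).toNat) atTop (nhds (b k)))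
    (z : ℂ) (hz : ‖z‖ < 1) (hz0 : z ≠ 0) (hg : g z = ∑' n : ℕ, a n * z ^ n) :
    Tendsto (fun j => tailFn a g (N j) z) atTop (nhds (∑' n : ℕ, b n * z ^ n)) := by
  simp only [tailFn_inside a C hC g _ z hz hz0 hg]
  refine tendsto_tsum_of_dominated_convergence
    ((summable_geometric_of_lt_one (norm_nonneg z) hz).mul_left C) ?_ ?_
  · intro k
    refine Tendsto.mul_const _ ?_
    refine (hb k).congr fun j => ?_
    congr 1
  · refine Eventually.of_forall fun j k => ?_
    rw [norm_mul, norm_pow]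
    gcongr
    exact hC _

lemma tailFn_tendsto_outside (a : ℕ → ℂ) (C : ℝ) (hC : ∀ n, ‖a n‖ ≤ C) (g : ℂ → ℂ) (N : ℕ → ℕ)
    (hN : Tendsto N atTop atTop)
    (b : ℤ → ℂ) (hb : ∀ k : ℤ, Tendsto (fun j => a (k + N j).toNat) atTop (nhds (b k)))
    (z : ℂ) (hz : 1 < ‖z‖) :
    Tendsto (fun j => tailFn a g (N j) z) atTop
      (nhds (-(z⁻¹ * ∑' n : ℕ, b (-(n : ℤ) - 1) * z⁻¹ ^ n))) := by
  have hC0 : 0 ≤ C := (norm_nonneg _).trans (hC 0)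
  have hw : ‖z⁻¹‖ < 1 := by rw [norm_inv]; exact inv_lt_one_of_one_lt₀ hz
  have h1 : Tendsto (fun j => z⁻¹ ^ N j * g z) atTop (nhds (0 * g z)) :=
    ((tendsto_pow_atTop_nhds_zero_of_norm_lt_one hw).comp hN).mul_const _
  have h2 : Tendsto (fun j => ∑' m : ℕ, (if m < N j then a (N j - 1 - m) * z⁻¹ ^ m else 0)) atTop
      (nhds (∑' n : ℕ, b (-(n : ℤ) - 1) * z⁻¹ ^ n)) := by
    refine tendsto_tsum_of_dominated_convergence
      ((summable_geometric_of_lt_one (norm_nonneg _) hw).mul_left C) ?_ ?_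
    · intro k
      refine ((hb (-(k : ℤ) - 1)).mul_const (z⁻¹ ^ k)).congr' ?_
      filter_upwards [hN.eventually_gt_atTop k] with j hj
      rw [if_pos hj]
      congr 2
      omega
    · refine Eventually.of_forall fun j k => ?_
      split_ifs
      · rw [norm_mul, norm_pow]
        gcongr
        exact hC _
      · rw [norm_zero]; positivity
  have h3 : ∀ j, ∑' m : ℕ, (if m < N j then a (N j - 1 - m) * z⁻¹ ^ m else 0)
      = ∑ m ∈ Finset.range (N j), a (N j - 1 - m) * z⁻¹ ^ m := by
    intro j
    rw [tsum_eq_sum (s := Finset.range (N j))]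
    · exact Finset.sum_congr rfl fun m hm => if_pos (Finset.mem_range.1 hm)
    · intro m hm
      exact if_neg (by simpa using hm)
  simp only [h3] at h2
  have := h1.sub (h2.const_mul z⁻¹)
  simpa [tailFn] using this

/-- A quadratic polynomial whose modulus on the circle of radius `ρ` about `z₀` is
`ρ * |‖z‖ ^ 2 - 1|`. -/
noncomputable def qpol (z₀ : ℂ) (ρ : ℝ) (z : ℂ) : ℂ :=
  z * ((starRingEnd ℂ) z₀ * (z - z₀) + (ρ : ℂ) ^ 2) - (z - z₀)

lemma qpol_norm (z₀ : ℂ) (ρ : ℝ) (z : ℂ) (hz : z ∈ sphere z₀ ρ) :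
    ‖qpol z₀ ρ z‖ = ρ * |‖z‖ ^ 2 - 1| := by
  have h1 : ‖z - z₀‖ = ρ := by simpa [dist_eq_norm] using hz
  have h2 : (z - z₀) * (starRingEnd ℂ) (z - z₀) = (ρ : ℂ) ^ 2 := by
    rw [Complex.mul_conj', h1]
  have h3 : z * (starRingEnd ℂ) z = (‖z‖ : ℂ) ^ 2 := Complex.mul_conj' z
  have h4 : qpol z₀ ρ z = (z - z₀) * ((‖z‖ ^ 2 - 1 : ℝ) : ℂ) := by
    unfold qpol
    rw [← h2]
    push_cast
    rw [← h3, map_sub]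
    ring
  rw [h4, norm_mul, h1, Complex.norm_real, Real.norm_eq_abs]

lemma qpol_ne (z₀ : ℂ) (hz₀ : ‖z₀‖ = 1) (ρ : ℝ) (hρ : 0 < ρ) (t : ℝ) (ht : 0 < t) :
    qpol z₀ ρ (t * z₀) ≠ 0 := by
  have h3 : z₀ * (starRingEnd ℂ) z₀ = 1 := by rw [Complex.mul_conj', hz₀]; simp
  have h4 : qpol z₀ ρ (t * z₀) = z₀ * (((t - 1) ^ 2 + t * ρ ^ 2 : ℝ) : ℂ) := by
    unfold qpol
    push_cast
    linear_combination (t * z₀ * (t - 1)) * h3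
  rw [h4]
  refine mul_ne_zero (by rintro rfl; simp at hz₀) ?_
  rw [Complex.ofReal_ne_zero]
  positivity

lemma qpol_diff (z₀ : ℂ) (ρ : ℝ) : Differentiable ℂ (qpol z₀ ρ) := by
  unfold qpol
  fun_prop

lemma core_aux (a : ℕ → ℂ) (C : ℝ) (hC : ∀ n, ‖a n‖ ≤ C) (g : ℂ → ℂ) (N N' : ℕ → ℕ)
    (hN : Tendsto N atTop atTop) (hN' : Tendsto N' atTop atTop) (b c : ℤ → ℂ)
    (hb : ∀ k : ℤ, Tendsto (fun j => a (k + N j).toNat) atTop (nhds (b k)))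
    (hc : ∀ k : ℤ, Tendsto (fun j => a (k + N' j).toNat) atTop (nhds (c k)))
    (z₀ : ℂ) (hz₀ : ‖z₀‖ = 1) (ρ : ℝ) (hρ : 0 < ρ) (hρ1 : ρ < 1)
    (hgd : DifferentiableOn ℂ g (closedBall z₀ ρ))
    (hg : ∀ z ∈ ball (0 : ℂ) 1, g z = ∑' n : ℕ, a n * z ^ n) :
    ∃ F : ℂ → ℂ, AnalyticOnNhd ℂ F (ball z₀ ρ) ∧
      (∀ z ∈ ball z₀ ρ, ‖z‖ < 1 →
        F z = qpol z₀ ρ z * ((∑' n : ℕ, b n * z ^ n) - ∑' n : ℕ, c n * z ^ n)) ∧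
      (∀ z ∈ ball z₀ ρ, 1 < ‖z‖ →
        F z = qpol z₀ ρ z * (-(z⁻¹ * ∑' n : ℕ, b (-(n : ℤ) - 1) * z⁻¹ ^ n)
          - -(z⁻¹ * ∑' n : ℕ, c (-(n : ℤ) - 1) * z⁻¹ ^ n))) := by
  have hne : ∀ z ∈ closedBall z₀ ρ, z ≠ 0 := by
    rintro z hz rfl
    rw [mem_closedBall, dist_zero_left, hz₀] at hz
    linarith
  have hle : ∀ z ∈ closedBall z₀ ρ, ‖z‖ ≤ 2 := by
    intro z hz
    rw [mem_closedBall, dist_eq_norm] at hz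
    have := norm_le_norm_add_norm_sub' z z₀
    linarith
  obtain ⟨G, hG⟩ := (isCompact_closedBall z₀ ρ).exists_bound_of_continuousOn hgd.continuousOn
  have hG0 : 0 ≤ G := (norm_nonneg _).trans (hG z₀ (mem_closedBall_self hρ.le))
  have hC0 : 0 ≤ C := (norm_nonneg _).trans (hC 0)
  set h : ℕ → ℂ → ℂ := fun j z => qpol z₀ ρ z * (tailFn a g (N j) z - tailFn a g (N' j) z) with hh
  have hin : ∀ z ∈ closedBall z₀ ρ, ‖z‖ < 1 → Tendsto (fun j => h j z) atTop
      (nhds (qpol z₀ ρ z * ((∑' n : ℕ, b n * z ^ n) - ∑' n : ℕ, c n * z ^ n))) := by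
    intro z hz hz1
    have hgz := hg z (by simpa using hz1)
    exact ((tailFn_tendsto_inside a C hC g N b hb z hz1 (hne z hz) hgz).sub
      (tailFn_tendsto_inside a C hC g N' c hc z hz1 (hne z hz) hgz)).const_mul _
  have hout : ∀ z ∈ closedBall z₀ ρ, 1 < ‖z‖ → Tendsto (fun j => h j z) atTop
      (nhds (qpol z₀ ρ z * (-(z⁻¹ * ∑' n : ℕ, b (-(n : ℤ) - 1) * z⁻¹ ^ n)
          - -(z⁻¹ * ∑' n : ℕ, c (-(n : ℤ) - 1) * z⁻¹ ^ n)))) := by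
    intro z hz hz1
    exact ((tailFn_tendsto_outside a C hC g N hN b hb z hz1).sub
      (tailFn_tendsto_outside a C hC g N' hN' c hc z hz1)).const_mul _
  have hzero : ∀ z ∈ sphere z₀ ρ, ‖z‖ = 1 → qpol z₀ ρ z = 0 := by
    intro z hz hz1
    rw [← norm_eq_zero, qpol_norm z₀ ρ z hz, hz1]
    simp
  have htail : ∀ n, DifferentiableOn ℂ (tailFn a g n) (closedBall z₀ ρ) := by
    intro n
    have hi : DifferentiableOn ℂ (fun z : ℂ => z⁻¹) (closedBall z₀ ρ) :=
      fun z hz => (differentiableAt_inv (hne z hz)).differentiableWithinAt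
    unfold tailFn
    refine ((hi.pow n).mul hgd).sub (hi.mul ?_)
    refine DifferentiableOn.fun_sum fun m _ => ?_
    exact (hi.pow m).const_mul _
  have hL : ∀ z ∈ sphere z₀ ρ, ∃ l, Tendsto (fun j => h j z) atTop (nhds l) := by
    intro z hz
    have hz' := sphere_subset_closedBall hz
    rcases lt_trichotomy ‖z‖ 1 with h1 | h1 | h1
    · exact ⟨_, hin z hz' h1⟩
    · refine ⟨0, ?_⟩
      simp [hh, hzero z hz h1]
    · exact ⟨_, hout z hz' h1⟩
  choose! L hL using hL
  have hbound : ∀ j, ∀ z ∈ sphere z₀ ρ, ‖h j z‖ ≤ ρ * 3 * (2 * (G + C)) := by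
    intro j z hz
    have hz' := sphere_subset_closedBall hz
    by_cases h1 : ‖z‖ = 1
    · simp only [hh, hzero z hz h1, zero_mul, norm_zero]
      positivity
    · have hb1 := fun n => tailFn_bound a C hC g n z (hne z hz') h1 (hle z hz')
        (fun h => hg z (by simpa using h)) G (hG z hz')
      have hsq : |‖z‖ ^ 2 - 1| = (‖z‖ + 1) * |‖z‖ - 1| := by
        rw [show ‖z‖ ^ 2 - 1 = (‖z‖ + 1) * (‖z‖ - 1) by ring, abs_mul,
          abs_of_pos (by positivity)]
      have h2 := hle z hz'
      calc ‖h j z‖ = ρ * (‖z‖ + 1) * (‖tailFn a g (N j) z - tailFn a g (N' j) z‖ * |‖z‖ - 1|) := by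
            simp only [hh]
            rw [norm_mul, qpol_norm z₀ ρ z hz, hsq]
            ring
        _ ≤ ρ * 3 * (2 * (G + C)) := by
            have h3 : ‖tailFn a g (N j) z - tailFn a g (N' j) z‖ * |‖z‖ - 1| ≤ 2 * (G + C) := by
              calc _ ≤ (‖tailFn a g (N j) z‖ + ‖tailFn a g (N' j) z‖) * |‖z‖ - 1| :=
                    mul_le_mul_of_nonneg_right (norm_sub_le _ _) (abs_nonneg _)
                _ ≤ _ := by
                    rw [add_mul]
                    linarith [hb1 (N j), hb1 (N' j)]
            have h4 : ρ * (‖z‖ + 1) ≤ ρ * 3 := mul_le_mul_of_nonneg_left (by linarith) hρ.le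
            exact mul_le_mul h4 h3 (by positivity) (by positivity)
  obtain ⟨F, hF, hFt⟩ := vitali_aux h z₀ ρ hρ (ρ * 3 * (2 * (G + C))) L
    (fun j => (qpol_diff z₀ ρ).differentiableOn.mul ((htail _).sub (htail _))) hbound hL
  · refine ⟨F, hF, ?_, ?_⟩
    · intro z hz hz1
      exact tendsto_nhds_unique (hFt z hz) (hin z (ball_subset_closedBall hz) hz1)
    · intro z hz hz1
      exact tendsto_nhds_unique (hFt z hz) (hout z (ball_subset_closedBall hz) hz1)

lemma rlim_bound (a : ℕ → ℂ) (C : ℝ) (hC : ∀ n, ‖a n‖ ≤ C) (N : ℕ → ℕ) (b : ℤ → ℂ)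
    (hb : ∀ k : ℤ, Tendsto (fun j => a (k + N j).toNat) atTop (nhds (b k))) (k : ℤ) :
    ‖b k‖ ≤ C :=
  le_of_tendsto (hb k).norm (Eventually.of_forall fun _ => hC _)

lemma point_aux (z₀ : ℂ) (hz₀ : ‖z₀‖ = 1) (ρ : ℝ) (t : ℝ) (ht : 0 < t) (h : |t - 1| < ρ) :
    (t * z₀ : ℂ) ∈ ball z₀ ρ ∧ ‖(t * z₀ : ℂ)‖ = t := by
  constructor
  · rw [mem_ball, dist_eq_norm, show (t * z₀ - z₀ : ℂ) = ((t - 1 : ℝ) : ℂ) * z₀ by push_cast; ring,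
      norm_mul, hz₀, Complex.norm_real, mul_one]
    exact h
  · rw [norm_mul, hz₀, Complex.norm_real, mul_one, Real.norm_eq_abs, abs_of_pos ht]

lemma core_right (a : ℕ → ℂ) (C : ℝ) (hC : ∀ n, ‖a n‖ ≤ C) (g : ℂ → ℂ) (N N' : ℕ → ℕ)
    (hN : Tendsto N atTop atTop) (hN' : Tendsto N' atTop atTop) (b c : ℤ → ℂ)
    (hb : ∀ k : ℤ, Tendsto (fun j => a (k + N j).toNat) atTop (nhds (b k)))
    (hc : ∀ k : ℤ, Tendsto (fun j => a (k + N' j).toNat) atTop (nhds (c k)))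
    (z₀ : ℂ) (hz₀ : ‖z₀‖ = 1) (ρ : ℝ) (hρ : 0 < ρ) (hρ1 : ρ < 1)
    (hgd : DifferentiableOn ℂ g (closedBall z₀ ρ))
    (hg : ∀ z ∈ ball (0 : ℂ) 1, g z = ∑' n : ℕ, a n * z ^ n) :
    (∀ n : ℕ, b n = c n) ↔ (∀ n : ℕ, b (-(n : ℤ) - 1) = c (-(n : ℤ) - 1)) := by
  obtain ⟨F, hF, hFin, hFout⟩ :=
    core_aux a C hC g N N' hN hN' b c hb hc z₀ hz₀ ρ hρ hρ1 hgd hg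
  obtain ⟨hi1, hi2⟩ := point_aux z₀ hz₀ ρ (1 - ρ / 2) (by linarith)
    (by rw [abs_lt]; constructor <;> linarith)
  obtain ⟨ho1, ho2⟩ := point_aux z₀ hz₀ ρ (1 + ρ / 2) (by linarith)
    (by rw [abs_lt]; constructor <;> linarith)
  have hPi := qpol_ne z₀ hz₀ ρ hρ (1 - ρ / 2) (by linarith)
  have hPo := qpol_ne z₀ hz₀ ρ hρ (1 + ρ / 2) (by linarith)
  set zi : ℂ := ((1 - ρ / 2 : ℝ) : ℂ) * z₀
  set zo : ℂ := ((1 + ρ / 2 : ℝ) : ℂ) * z₀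
  have hPc : Continuous (qpol z₀ ρ) := (qpol_diff z₀ ρ).continuous
  have hBi : ∀ᶠ z in nhds zi, z ∈ ball z₀ ρ ∧ ‖z‖ < 1 ∧ qpol z₀ ρ z ≠ 0 := by
    refine (isOpen_ball.eventually_mem hi1).and (Eventually.and ?_ (hPc.continuousAt.eventually_ne hPi))
    exact continuous_norm.continuousAt.eventually_lt continuousAt_const (by simp only [hi2]; linarith)
  have hBo : ∀ᶠ z in nhds zo, z ∈ ball z₀ ρ ∧ 1 < ‖z‖ ∧ qpol z₀ ρ z ≠ 0 := by
    refine (isOpen_ball.eventually_mem ho1).and (Eventually.and ?_ (hPc.continuousAt.eventually_ne hPo))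
    exact continuousAt_const.eventually_lt continuous_norm.continuousAt (by simp only [ho2]; linarith)
  have hbC := rlim_bound a C hC N b hb
  have hcC := rlim_bound a C hC N' c hc
  have hsub : ∀ (k : ℕ → ℤ) (w : ℂ), ‖w‖ < 1 → ∑' n : ℕ, (b (k n) - c (k n)) * w ^ n
      = (∑' n : ℕ, b (k n) * w ^ n) - ∑' n : ℕ, c (k n) * w ^ n := by
    intro k w hw
    rw [← (summable_aux (fun n => b (k n)) C (fun n => hbC _) w hw).tsum_sub
      (summable_aux (fun n => c (k n)) C (fun n => hcC _) w hw)]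
    exact tsum_congr fun n => sub_mul _ _ _
  have hbd : ∀ (k : ℕ → ℤ) n, ‖b (k n) - c (k n)‖ ≤ C + C := fun k n =>
    (norm_sub_le _ _).trans (add_le_add (hbC _) (hcC _))
  constructor
  · intro hbc
    have hF0 : EqOn F 0 (ball z₀ ρ) := by
      refine hF.eqOn_zero_of_preconnected_of_eventuallyEq_zero
        (convex_ball _ _).isPreconnected hi1 ?_
      filter_upwards [hBi] with z hz
      rw [hFin z hz.1 hz.2.1]
      simp [hbc]
    have hzo0 : zo ≠ 0 := by rw [← norm_ne_zero_iff, ho2]; linarith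
    have key := coeff_zero_aux (fun n => b (-(n : ℤ) - 1) - c (-(n : ℤ) - 1)) (C + C)
      (hbd fun n => -(n : ℤ) - 1) zo⁻¹
      (by rw [norm_inv, ho2]; exact inv_lt_one_of_one_lt₀ (by linarith)) ?_
    · exact fun n => sub_eq_zero.1 (key n)
    · have ht : Tendsto (fun w : ℂ => w⁻¹) (nhds zo⁻¹) (nhds zo) := by
        have := (continuousAt_inv₀ (inv_ne_zero hzo0)).tendsto
        rwa [inv_inv] at this
      filter_upwards [ht.eventually hBo] with w hw
      have h1 := hFout _ hw.1 hw.2.1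
      rw [hF0 hw.1] at h1
      have hw0 : w ≠ 0 := by
        rintro rfl
        have := hw.2.1
        norm_num at this
      have hw1 : ‖w‖ < 1 := by
        have := hw.2.1
        rw [norm_inv] at this
        exact (one_lt_inv₀ (norm_pos_iff.2 hw0)).1 this
      rw [hsub (fun n => -(n : ℤ) - 1) w hw1]
      have h2 := (mul_eq_zero.1 h1.symm).resolve_left hw.2.2
      rw [inv_inv] at h2
      have h3 : w * ((∑' n : ℕ, b (-(n : ℤ) - 1) * w ^ n)
          - ∑' n : ℕ, c (-(n : ℤ) - 1) * w ^ n) = 0 := by linear_combination -h2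
      exact (mul_eq_zero.1 h3).resolve_left hw0
  · intro hbc
    have hF0 : EqOn F 0 (ball z₀ ρ) := by
      refine hF.eqOn_zero_of_preconnected_of_eventuallyEq_zero
        (convex_ball _ _).isPreconnected ho1 ?_
      filter_upwards [hBo] with z hz
      rw [hFout z hz.1 hz.2.1]
      simp [hbc]
    have key := coeff_zero_aux (fun n => b (n : ℤ) - c (n : ℤ)) (C + C)
      (hbd fun n => (n : ℤ)) zi (by rw [hi2]; linarith) ?_
    · exact fun n => sub_eq_zero.1 (key n)
    · filter_upwards [hBi] with w hw
      have h1 := hFin _ hw.1 hw.2.1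
      rw [hF0 hw.1] at h1
      rw [hsub (fun n => (n : ℤ)) w hw.2.1]
      exact (mul_eq_zero.1 h1.symm).resolve_left hw.2.2

lemma shift_aux (a : ℕ → ℂ) (N : ℕ → ℕ) (hN : StrictMono N) (b : ℤ → ℂ)
    (hb : ∀ k : ℤ, Tendsto (fun j => a (k + N j).toNat) atTop (nhds (b k))) (s : ℤ) :
    Tendsto (fun j => (s + N j).toNat) atTop atTop ∧
    ∀ k : ℤ, Tendsto (fun j => a (k + ((s + N j).toNat : ℕ)).toNat) atTop (nhds (b (k + s))) := by
  have hN' := hN.tendsto_atTop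
  constructor
  · rw [Filter.tendsto_atTop]
    intro m
    filter_upwards [hN'.eventually_ge_atTop (m + s.natAbs)] with j hj
    omega
  · intro k
    refine (hb (k + s)).congr' ?_
    filter_upwards [hN'.eventually_ge_atTop s.natAbs] with j hj
    congr 1
    omega

theorem stmt10 (a : ℕ → ℂ) (C : ℝ) (hC : ∀ n, ‖a n‖ ≤ C)
    (b c : ℤ → ℂ) (hb : IsRightLimit a b) (hc : IsRightLimit a c)
    (hne : b 0 ≠ c 0)
    (htail : (∃ k : ℤ, 0 < k ∧ ∀ j : ℤ, k ≤ j → b j = c j) ∨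
             (∃ k : ℤ, k < 0 ∧ ∀ j : ℤ, j ≤ k → b j = c j))
    (f : ℂ → ℂ) (hf : ∀ z ∈ Metric.ball (0 : ℂ) 1, f z = ∑' n : ℕ, a n * z ^ n) :
    NaturalBoundary f := by
  rintro ⟨z₀, hz₀, δ, hδ, g, hgd, hgf⟩
  obtain ⟨N, hN, hb⟩ := hb
  obtain ⟨N', hN', hc⟩ := hc
  set ρ : ℝ := min δ 1 / 2 with hρdef
  have hm : 0 < min δ 1 := lt_min hδ one_pos
  have hm1 := min_le_left δ 1
  have hm2 := min_le_right δ 1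
  have hgd' : DifferentiableOn ℂ g (closedBall z₀ ρ) :=
    hgd.mono ((closedBall_subset_ball (by linarith)).trans subset_union_right)
  have hg : ∀ z ∈ ball (0 : ℂ) 1, g z = ∑' n : ℕ, a n * z ^ n := fun z hz => by
    rw [hgf z hz, hf z hz]
  have key : ∀ s : ℤ, (∀ n : ℕ, b (n + s) = c (n + s)) ↔
      (∀ n : ℕ, b (-(n : ℤ) - 1 + s) = c (-(n : ℤ) - 1 + s)) := fun s =>
    core_right a C hC g _ _ (shift_aux a N hN b hb s).1 (shift_aux a N' hN' c hc s).1
      (fun k => b (k + s)) (fun k => c (k + s)) (shift_aux a N hN b hb s).2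
      (shift_aux a N' hN' c hc s).2 z₀ hz₀ ρ (by linarith) (by linarith) hgd' hg
  rcases htail with ⟨k, hk, h⟩ | ⟨k, hk, h⟩
  · have := (key k).1 (fun n => h _ (by omega)) (k - 1).toNat
    rw [show -((k - 1).toNat : ℤ) - 1 + k = 0 by omega] at this
    exact hne this
  · have := (key (k + 1)).2 (fun n => h _ (by omega)) (-(k + 1)).toNat
    rw [show ((-(k + 1)).toNat : ℤ) + (k + 1) = 0 by omega] at this
    exact hne this
end

section
/- Let (a_n)_{n≥0} be a bounded sequence of complex numbers admitting two right limits b, c : ℤ → ℂ such that b_0 ≠ c_0 and either: there is k > 0 with b_j = c_j for all j ≥ k, or there is k < 0 with b_j = c_j for all j ≤ k. Then f(z) = Σ_{n=0}^∞ a_n z^n has a strong natural boundary on ∂𝔻. -/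
open Filter Metric Set MeasureTheory

open scoped Topology NNReal ENNReal


lemma sn_rajchman {T : ℝ} [Fact (0 < T)] (ν : Measure (AddCircle T)) [IsFiniteMeasure ν]
    (h : AddCircle T → ℂ) (hm : Measurable h) (hi : Integrable h ν)
    (h0 : Tendsto (fun m : ℤ => ∫ x, fourier m x * h x ∂ν) atTop (𝓝 0)) :
    Tendsto (fun m : ℤ => ∫ x, fourier (-m) x * h x ∂ν) atTop (𝓝 0) := by
  have nf : ∀ (m : ℤ) (x : AddCircle T), ‖(fourier m x : ℂ)‖ = 1 := fun m x => by
    rw [fourier_apply]; exact Circle.norm_coe _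
  have key : ∀ {g g' : AddCircle T → ℂ} (m : ℤ), Integrable (fun x => g x * h x) ν →
      Integrable (fun x => g' x * h x) ν →
      ‖∫ x, fourier m x * (g x * h x) ∂ν‖ ≤ ‖∫ x, fourier m x * (g' x * h x) ∂ν‖ +
        ∫ x, ‖(g x - g' x) * h x‖ ∂ν := by
    intro g g' m hg hg'
    have i1 : ∀ {u : AddCircle T → ℂ}, Integrable u ν →
        Integrable (fun x => fourier m x * u x) ν := by
      intro u hu
      refine hu.bdd_mul (c := 1) (fourier m).continuous.aestronglyMeasurable ?_
      filter_upwards with x using (nf m x).le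
    have e : ∫ x, fourier m x * (g x * h x) ∂ν = ∫ x, fourier m x * (g' x * h x) ∂ν
        + ∫ x, fourier m x * ((g x - g' x) * h x) ∂ν := by
      rw [← integral_add (i1 hg')]
      · congr 1; ext x; ring
      · apply i1
        simp only [sub_mul]
        exact hg.sub hg'
    rw [e]
    refine (norm_add_le _ _).trans (add_le_add le_rfl ?_)
    refine (norm_integral_le_integral_norm _).trans (le_of_eq ?_)
    congr 1; ext x; rw [norm_mul, nf, one_mul]
  have cint : ∀ g : C(AddCircle T, ℂ), Integrable (fun x => g x * h x) ν := by
    intro g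
    refine hi.bdd_mul (c := ‖g‖) g.continuous.aestronglyMeasurable ?_
    filter_upwards with x using g.norm_coe_le_norm x
  have hcont : ∀ g : C(AddCircle T, ℂ),
      Tendsto (fun m : ℤ => ∫ x, fourier m x * (g x * h x) ∂ν) atTop (𝓝 0) := by
    have hspan : ∀ g ∈ Submodule.span ℂ (range <| @fourier T),
        Tendsto (fun m : ℤ => ∫ x, fourier m x * (g x * h x) ∂ν) atTop (𝓝 0) := by
      intro g hg
      have i1 : ∀ (m : ℤ) (g : C(AddCircle T, ℂ)),
          Integrable (fun x => fourier m x * (g x * h x)) ν := by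
        intro m g
        have := cint (fourier m * g)
        simpa [mul_assoc] using this
      induction hg using Submodule.span_induction with
      | mem x hx =>
        obtain ⟨k, rfl⟩ := hx
        have := h0.comp (tendsto_atTop_add_const_right atTop k tendsto_id)
        refine this.congr (fun m => ?_)
        simp [mul_assoc]
      | zero => simp
      | add x y _ _ hx hy =>
        have := hx.add hy
        simp only [add_zero] at this
        refine this.congr (fun m => ?_)
        rw [← integral_add (i1 _ _) (i1 _ _)]
        congr 1; ext z; simp; ring
      | smul c x _ hx =>
        have := hx.const_mul c
        simp only [mul_zero] at this
        refine this.congr (fun m => ?_)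
        rw [← integral_const_mul]
        congr 1; ext z; simp; ring
    intro g
    rw [Metric.tendsto_nhds]
    intro ε hε
    set K := ∫ x, ‖h x‖ ∂ν
    have hK : 0 ≤ K := integral_nonneg (fun x => norm_nonneg _)
    have hg : g ∈ (Submodule.span ℂ (range <| @fourier T)).topologicalClosure := by
      rw [span_fourier_closure_eq_top]; trivial
    obtain ⟨g', hg', hd⟩ := Metric.mem_closure_iff.1 hg (ε / 2 / (K + 1)) (by positivity)
    filter_upwards [Metric.tendsto_nhds.1 (hspan g' hg') (ε / 2) (by positivity)] with m hm'
    rw [dist_zero_right] at hm' ⊢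
    refine (key m (cint g) (cint g')).trans_lt ?_
    have : ∫ x, ‖(g x - g' x) * h x‖ ∂ν ≤ ε / 2 / (K + 1) * K := by
      rw [← integral_const_mul]
      refine integral_mono ?_ (hi.norm.const_mul _) ?_
      · simpa using (cint (g - g')).norm
      · intro x
        simp only [norm_mul]
        gcongr
        rw [dist_eq_norm] at hd
        exact ((g - g').norm_coe_le_norm x).trans hd.le
    have h2 : ε / 2 / (K + 1) * K ≤ ε / 2 := by
      rw [div_mul_eq_mul_div, div_le_iff₀ (by positivity)]; nlinarith
    linarith
  set g0 : AddCircle T → ℂ := fun x => (starRingEnd ℂ) (h x) / h x with hg0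
  have g0m : Measurable g0 := (Complex.continuous_conj.measurable.comp hm).div hm
  have g0b : ∀ x, ‖g0 x‖ ≤ 1 := by
    intro x; simp only [hg0, norm_div, RCLike.norm_conj]; exact div_self_le_one _
  have g0h : ∀ x, g0 x * h x = (starRingEnd ℂ) (h x) := by
    intro x
    by_cases hx : h x = 0
    · simp [hg0, hx]
    · simp [hg0, hx]
  have main : Tendsto (fun m : ℤ => ∫ x, fourier m x * (g0 x * h x) ∂ν) atTop (𝓝 0) := by
    rw [Metric.tendsto_nhds]
    intro ε hε
    let l : Measure (AddCircle T) := ν.withDensity (fun x => ‖h x‖ₑ)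
    have : IsFiniteMeasure l := isFiniteMeasure_withDensity hi.2.ne
    have g0i : Integrable g0 l := Integrable.of_bound g0m.aestronglyMeasurable 1
      (by filter_upwards with x using g0b x)
    obtain ⟨g, hg, hgi⟩ := g0i.exists_boundedContinuous_integral_sub_le (ε := ε / 2) (by positivity)
    rw [integral_withDensity_eq_integral_toReal_smul hm.enorm
      (by filter_upwards with x using enorm_lt_top)] at hg
    filter_upwards [Metric.tendsto_nhds.1 (hcont g.toContinuousMap) (ε / 2) (by positivity)]
      with m hm'
    rw [dist_zero_right] at hm' ⊢
    have i0 : Integrable (fun x => g0 x * h x) ν :=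
      hi.bdd_mul (c := 1) g0m.aestronglyMeasurable (by filter_upwards with x using g0b x)
    refine (key m i0 (cint g.toContinuousMap)).trans_lt ?_
    have : ∫ x, ‖(g0 x - g.toContinuousMap x) * h x‖ ∂ν ≤ ε / 2 := by
      refine le_trans (le_of_eq ?_) hg
      congr 1; ext x; simp [mul_comm]
    linarith
  have := (Complex.continuous_conj.tendsto _).comp main
  simp only [map_zero] at this
  refine this.congr (fun m => ?_)
  simp only [Function.comp, g0h]
  rw [← integral_conj]
  congr 1; ext x; simp

lemma sn_weak {X : Type*} [TopologicalSpace X] [T2Space X] [CompactSpace X] [MeasurableSpace X]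
    [BorelSpace X] (U : Ultrafilter ℕ) (μ : ℕ → Measure X)
    (C : ℝ≥0) (hμ : ∀ j, μ j univ ≤ C) :
    ∃ ν : Measure X, IsFiniteMeasure ν ∧ ∀ g : C(X, ℂ),
      Tendsto (fun j => ∫ x, g x ∂(μ j)) U (𝓝 (∫ x, g x ∂ν)) := by
  have hf : ∀ j, IsFiniteMeasure (μ j) := fun j => ⟨(hμ j).trans_lt ENNReal.coe_lt_top⟩
  let m : ℕ → FiniteMeasure X := fun j => ⟨μ j, hf j⟩
  have hc := isCompact_setOfPred_finiteMeasure_le_of_compactSpace X C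
  obtain ⟨ν, _, hν⟩ := isCompact_iff_ultrafilter_le_nhds'.1 hc (U.map m) (by
    rw [Ultrafilter.mem_map]
    filter_upwards with j
    simp only [mem_preimage, mem_ofPred_eq]
    rw [← ENNReal.coe_le_coe, FiniteMeasure.ennreal_mass]
    exact hμ j)
  refine ⟨ν, inferInstance, fun g => ?_⟩
  have ht : Tendsto m U (𝓝 ν) := hν
  rw [FiniteMeasure.tendsto_iff_forall_integral_tendsto] at ht
  let gr : BoundedContinuousFunction X ℝ := BoundedContinuousFunction.mkOfCompact
    ⟨fun x => (g x).re, Complex.continuous_re.comp g.continuous⟩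
  let gi : BoundedContinuousFunction X ℝ := BoundedContinuousFunction.mkOfCompact
    ⟨fun x => (g x).im, Complex.continuous_im.comp g.continuous⟩
  have dec : ∀ (κ : Measure X) [IsFiniteMeasure κ], ∫ x, g x ∂κ =
      ((∫ x, gr x ∂κ : ℝ) : ℂ) + ((∫ x, gi x ∂κ : ℝ) : ℂ) * Complex.I := by
    intro κ _
    have gint : Integrable (fun x => g x) κ :=
      (BoundedContinuousFunction.mkOfCompact g).integrable κ
    have := integral_re_add_im (𝕜 := ℂ) gint
    rw [← this]; rfl
  rw [dec]
  have e : (fun j => ∫ x, g x ∂(μ j)) = fun j => ((∫ x, gr x ∂(m j : Measure X) : ℝ) : ℂ) +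
      ((∫ x, gi x ∂(m j : Measure X) : ℝ) : ℂ) * Complex.I := by
    ext j; exact dec (μ j)
  rw [e]
  exact ((Complex.continuous_ofReal.tendsto _).comp (ht gr)).add
    (((Complex.continuous_ofReal.tendsto _).comp (ht gi)).mul_const _)

noncomputable def snPart (k : Fin 4) (z : ℂ) : ℝ≥0 :=
  match k with
  | 0 => z.re.toNNReal
  | 1 => (-z.re).toNNReal
  | 2 => z.im.toNNReal
  | 3 => (-z.im).toNNReal

noncomputable def snCoef (k : Fin 4) : ℂ :=
  match k with
  | 0 => 1
  | 1 => -1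
  | 2 => Complex.I
  | 3 => -Complex.I

lemma sn_part_sum (z : ℂ) : ∑ k, snCoef k * ((snPart k z : ℝ) : ℂ) = z := by
  have h : ∀ x : ℝ, max x 0 - max (-x) 0 = x := by
    intro x; rcases le_total 0 x with h | h <;> simp [h]
  simp only [Fin.sum_univ_four, snCoef, snPart, Real.coe_toNNReal']
  apply Complex.ext
  · simpa [sub_eq_add_neg] using h z.re
  · simpa [sub_eq_add_neg] using h z.im

lemma sn_part_le (k : Fin 4) (z : ℂ) : (snPart k z : ℝ) ≤ ‖z‖ := by
  have h1 := abs_le.1 (Complex.abs_re_le_norm z)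
  have h2 := abs_le.1 (Complex.abs_im_le_norm z)
  fin_cases k <;> simp [snPart, Real.coe_toNNReal'] <;> linarith

lemma sn_part_cont (k : Fin 4) : Continuous (snPart k) := by
  fin_cases k
  · exact continuous_real_toNNReal.comp Complex.continuous_re
  · exact continuous_real_toNNReal.comp Complex.continuous_re.neg
  · exact continuous_real_toNNReal.comp Complex.continuous_im
  · exact continuous_real_toNNReal.comp Complex.continuous_im.neg

lemma sn_cweak {X : Type*} [TopologicalSpace X] [T2Space X] [CompactSpace X] [MeasurableSpace X]
    [BorelSpace X] (U : Ultrafilter ℕ) (F : ℕ → ℝ → ℂ) (hF : ∀ j, Continuous (F j))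
    (s t : ℝ) (e : ℝ → X) (he : Continuous e) (M : ℝ≥0)
    (hM : ∀ j, ∫ θ in Ioc s t, ‖F j θ‖ ≤ M) :
    ∃ (ν : Measure X) (h : X → ℂ), IsFiniteMeasure ν ∧ Measurable h ∧ Integrable h ν ∧
      ∀ g : C(X, ℂ), Tendsto (fun j => ∫ θ in Ioc s t, g (e θ) * F j θ) U
        (𝓝 (∫ x, g x * h x ∂ν)) := by
  let μ : Fin 4 → ℕ → Measure X := fun k j =>
    ((volume.restrict (Ioc s t)).withDensity (fun θ => (snPart k (F j θ) : ℝ≥0∞))).map e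
  have fint : ∀ j, Integrable (F j) (volume.restrict (Ioc s t)) := fun j =>
    ((hF j).integrableOn_Icc).mono_set Ioc_subset_Icc_self
  have pm : ∀ k j, Measurable (fun θ => snPart k (F j θ)) := fun k j =>
    ((sn_part_cont k).comp (hF j)).measurable
  have hμ : ∀ k j, μ k j univ ≤ M := by
    intro k j
    rw [Measure.map_apply he.measurable MeasurableSet.univ, preimage_univ,
      withDensity_apply _ MeasurableSet.univ, setLIntegral_univ]
    have h1 := hM j
    calc ∫⁻ θ in Ioc s t, (snPart k (F j θ) : ℝ≥0∞) ≤ ∫⁻ θ in Ioc s t, ‖F j θ‖ₑ := by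
          apply lintegral_mono
          intro θ
          simp only [enorm, ENNReal.coe_le_coe]
          exact sn_part_le k _
      _ = ENNReal.ofReal (∫ θ in Ioc s t, ‖F j θ‖) :=
          (ofReal_integral_norm_eq_lintegral_enorm (fint j)).symm
      _ ≤ M := by
          rw [← ENNReal.ofReal_coe_nnreal]
          exact ENNReal.ofReal_le_ofReal h1
  have hw := fun k => sn_weak U (μ k) M (hμ k)
  choose ν hν hlim using hw
  let N : Measure X := ∑ k, ν k
  have hNf : IsFiniteMeasure N := by infer_instance
  have hac : ∀ k, ν k ≪ N := by
    intro k
    apply Measure.absolutelyContinuous_of_le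
    exact Finset.single_le_sum (f := ν) (fun i _ => Measure.zero_le _) (Finset.mem_univ k)
  let h : X → ℂ := fun x => ∑ k, snCoef k * ((((ν k).rnDeriv N x).toReal : ℝ) : ℂ)
  have hrm : ∀ k, Measurable fun x => ((((ν k).rnDeriv N x).toReal : ℝ) : ℂ) := fun k =>
    Complex.measurable_ofReal.comp (Measure.measurable_rnDeriv _ _).ennreal_toReal
  have hri : ∀ k, Integrable (fun x => ((((ν k).rnDeriv N x).toReal : ℝ) : ℂ)) N := fun k =>
    Measure.integrable_toReal_rnDeriv.ofReal
  refine ⟨N, h, hNf, ?_, ?_, ?_⟩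
  · exact Finset.measurable_sum _ fun k _ => (hrm k).const_mul _
  · exact integrable_finsetSum _ fun k _ => (hri k).const_mul _
  · intro g
    have e1 : ∫ x, g x * h x ∂N = ∑ k, snCoef k * ∫ x, g x ∂(ν k) := by
      have : ∀ x, g x * h x = ∑ k, snCoef k * (g x * ((((ν k).rnDeriv N x).toReal : ℝ) : ℂ)) := by
        intro x; simp only [h, Finset.mul_sum]; congr 1; ext k; ring
      simp_rw [this]
      rw [integral_finsetSum]
      · congr 1; ext k
        rw [integral_const_mul, ← integral_rnDeriv_smul (hac k)]
        congr 2; ext x; simp [mul_comm]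
      · intro k _
        refine Integrable.const_mul ?_ _
        refine (hri k).bdd_mul (c := ‖g‖) g.continuous.aestronglyMeasurable ?_
        filter_upwards with x using g.norm_coe_le_norm x
    have e2 : ∀ j, ∫ θ in Ioc s t, g (e θ) * F j θ = ∑ k, snCoef k * ∫ x, g x ∂(μ k j) := by
      intro j
      have : ∀ θ, g (e θ) * F j θ = ∑ k, snCoef k * ((snPart k (F j θ)) • g (e θ)) := by
        intro θ
        conv_lhs => rw [← sn_part_sum (F j θ)]
        rw [Finset.mul_sum]; congr 1; ext k
        rw [NNReal.smul_def, Complex.real_smul]; ring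
      simp_rw [this]
      rw [integral_finsetSum]
      · congr 1; ext k
        rw [integral_const_mul]
        congr 1
        rw [integral_map he.measurable.aemeasurable g.continuous.aestronglyMeasurable,
          integral_withDensity_eq_integral_smul (pm k j)]
      · intro k _
        refine Integrable.const_mul ?_ _
        have : Continuous fun θ => (snPart k (F j θ)) • g (e θ) := by
          have := (sn_part_cont k).comp (hF j)
          exact this.smul (g.continuous.comp he)
        exact (this.integrableOn_Icc).mono_set Ioc_subset_Icc_self
    simp_rw [e1, e2]
    exact tendsto_finsetSum _ fun k _ => (hlim k g).const_mul _


/-- Fourier type coefficient over one period centered at `t`. -/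
noncomputable def snCf (t : ℝ) (u : ℝ → ℂ) (n : ℤ) : ℂ :=
  ∫ θ in (t - Real.pi)..(t + Real.pi), u θ * Complex.exp (n * θ * Complex.I)

noncomputable def snW (n : ℤ) : ℝ := if n = 0 then 1 else 1 / (n : ℝ) ^ 2

lemma sn_w_nonneg (n : ℤ) : 0 ≤ snW n := by
  unfold snW; split_ifs <;> positivity

lemma sn_w_summable : Summable snW := by
  have h : Summable (fun n : ℤ => 1 / (n : ℝ) ^ 2) :=
    Real.summable_one_div_int_pow.2 one_lt_two
  refine (h.add (hasSum_ite_eq (0 : ℤ) (1 : ℝ)).summable).congr (fun n => ?_)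
  unfold snW; by_cases hn : n = 0 <;> simp [hn]

lemma sn_exp_deriv (n : ℤ) (θ : ℝ) : HasDerivAt (fun θ : ℝ => Complex.exp (n * θ * Complex.I))
    (n * Complex.I * Complex.exp (n * θ * Complex.I)) θ := by
  have h1 : HasDerivAt (fun θ : ℝ => (n : ℂ) * θ * Complex.I) (n * Complex.I) θ := by
    have := ((Complex.ofRealCLM.hasDerivAt (x := θ)).const_mul (n : ℂ)).mul_const Complex.I
    simpa using this
  simpa [mul_comm] using h1.cexp

lemma sn_exp_norm (n : ℤ) (θ : ℝ) : ‖Complex.exp (n * θ * Complex.I)‖ = 1 := by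
  have := Complex.norm_exp_ofReal_mul_I (n * θ)
  simpa using this

lemma sn_exp_per (n : ℤ) (t : ℝ) : Complex.exp (n * ((t - Real.pi : ℝ) : ℂ) * Complex.I) =
    Complex.exp (n * ((t + Real.pi : ℝ) : ℂ) * Complex.I) := by
  rw [Complex.exp_eq_exp_iff_exists_int]
  exact ⟨-n, by push_cast; ring⟩

lemma sn_exp_cont (n : ℤ) : Continuous (fun θ : ℝ => Complex.exp (n * θ * Complex.I)) := by
  fun_prop

lemma sn_cf_le (t : ℝ) (u : ℝ → ℂ) (n : ℤ) (ε : ℝ)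
    (h : ∀ θ ∈ Icc (t - Real.pi) (t + Real.pi), ‖u θ‖ ≤ ε) : ‖snCf t u n‖ ≤ 2 * Real.pi * ε := by
  have hp := Real.pi_pos
  have := intervalIntegral.norm_integral_le_of_norm_le_const (a := t - Real.pi) (b := t + Real.pi)
    (f := fun θ => u θ * Complex.exp (n * θ * Complex.I)) (C := ε) (by
      intro θ hθ
      rw [uIoc_of_le (by linarith)] at hθ
      rw [norm_mul, sn_exp_norm, mul_one]
      exact h θ (Ioc_subset_Icc_self hθ))
  refine this.trans (le_of_eq ?_)
  rw [show t + Real.pi - (t - Real.pi) = 2 * Real.pi by ring, abs_of_pos (by positivity)]; ring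

lemma sn_cf_parts (t : ℝ) (u u' : ℝ → ℂ) (hu : ∀ θ, HasDerivAt u (u' θ) θ) (hc : Continuous u')
    (hp : u (t - Real.pi) = u (t + Real.pi)) (n : ℤ) :
    snCf t u' n = - (n * Complex.I) * snCf t u n := by
  unfold snCf
  have hcu : Continuous u := continuous_iff_continuousAt.2 fun θ => (hu θ).continuousAt
  have := intervalIntegral.integral_deriv_mul_eq_sub (a := t - Real.pi) (b := t + Real.pi)
    (fun θ _ => hu θ) (fun θ _ => sn_exp_deriv n θ) (hc.intervalIntegrable _ _)
    ((continuous_const.mul (sn_exp_cont n)).intervalIntegrable _ _)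
  have hE := sn_exp_cont n
  have c1 : Continuous fun θ : ℝ => u' θ * Complex.exp (n * θ * Complex.I) := by fun_prop
  have c2 : Continuous fun θ : ℝ => u θ * (n * Complex.I * Complex.exp (n * θ * Complex.I)) := by
    fun_prop
  rw [intervalIntegral.integral_add (c1.intervalIntegrable _ _)
    (c2.intervalIntegrable _ _), sn_exp_per, hp, sub_self] at this
  rw [eq_neg_of_add_eq_zero_left this, neg_mul, ← intervalIntegral.integral_const_mul]
  congr 2; ext θ; ring

lemma sn_cf_decay (t : ℝ) (u u' u'' : ℝ → ℂ) (hu : ∀ θ, HasDerivAt u (u' θ) θ)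
    (hu' : ∀ θ, HasDerivAt u' (u'' θ) θ) (hc : Continuous u'')
    (hp : u (t - Real.pi) = u (t + Real.pi)) (hp' : u' (t - Real.pi) = u' (t + Real.pi))
    (ε : ℝ) (h : ∀ θ ∈ Icc (t - Real.pi) (t + Real.pi), ‖u θ‖ ≤ ε)
    (h'' : ∀ θ ∈ Icc (t - Real.pi) (t + Real.pi), ‖u'' θ‖ ≤ ε) (n : ℤ) :
    ‖snCf t u n‖ ≤ 2 * Real.pi * ε * snW n := by
  unfold snW
  split_ifs with hn
  · rw [mul_one]; exact sn_cf_le t u n ε h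
  · have hcu : Continuous u' := continuous_iff_continuousAt.2 fun θ => (hu' θ).continuousAt
    have e1 := sn_cf_parts t u u' hu hcu hp n
    have e2 := sn_cf_parts t u' u'' hu' hc hp' n
    have e3 := sn_cf_le t u'' n ε h''
    rw [e2, e1] at e3
    simp only [norm_mul, norm_neg, Complex.norm_I, mul_one, Complex.norm_intCast] at e3
    have hn' : (0:ℝ) < (n : ℝ) ^ 2 := by positivity
    rw [mul_one_div, le_div_iff₀ hn', ← sq_abs]
    linarith [e3, sq_abs (n:ℝ)]

lemma sn_cf_one (t : ℝ) (n : ℤ) : snCf t (fun _ => 1) n = if n = 0 then 2 * (Real.pi : ℂ) else 0 := by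
  split_ifs with hn
  · subst hn; simp [snCf]; ring
  · have := sn_cf_parts t (fun _ => 1) (fun _ => 0) (fun θ => hasDerivAt_const _ _)
      continuous_const rfl n
    have h0 : snCf t (fun _ => 0) n = 0 := by simp [snCf]
    rw [h0] at this
    have h2 : (n : ℂ) ≠ 0 := by exact_mod_cast hn
    have := this.symm
    simpa [h2] using this

/-- peak polynomial -/
lemma sn_peak (η : ℝ) (hη : 0 < η) : ∃ (P : Polynomial ℂ) (ρ : ℝ), P.coeff 0 = 1 ∧ 0 < ρ ∧ ρ < 1 ∧
    ∀ w : ℂ, ‖w‖ = 1 → η ≤ ‖1 - w‖ → ‖P.eval w‖ ≤ ρ := by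
  obtain ⟨s, hs0, hs1, hsη, hsη2⟩ : ∃ s : ℝ, 0 < s ∧ s < 1 ∧ 1 - s ≤ η / 2 ∧
      4 * (1 - s ^ 2) ≤ η ^ 2 / 2 := by
    set x := min (1 / 2) (min (η / 2) (η ^ 2 / 16)) with hx
    have h1 : x ≤ 1 / 2 := min_le_left _ _
    have h2 : x ≤ η / 2 := (min_le_right _ _).trans (min_le_left _ _)
    have h3 : x ≤ η ^ 2 / 16 := (min_le_right _ _).trans (min_le_right _ _)
    have h0 : 0 < x := by positivity
    exact ⟨1 - x, by linarith, by linarith, by linarith, by nlinarith⟩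
  obtain ⟨K, hK⟩ : ∃ K : ℕ, s ^ (K + 1) * (2 / η) ≤ 1 / 8 := by
    have h1 : Tendsto (fun K : ℕ => s ^ (K + 1) * (2 / η)) atTop (𝓝 (0 * (2 / η))) :=
      ((tendsto_pow_atTop_nhds_zero_of_lt_one hs0.le hs1).comp (tendsto_add_atTop_nat 1)).mul_const _
    rw [zero_mul] at h1
    exact ((h1.eventually (ge_mem_nhds (by norm_num : (0:ℝ) < 1 / 8)))).exists
  set e : ℝ := 1 / (8 * ((K:ℝ) + 1) ^ 2) with he
  have hK1 : (0:ℝ) < (K:ℝ) + 1 := by positivity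
  have he0 : 0 < e := by positivity
  have heK : e * ((K:ℝ) + 1) ^ 2 = 1 / 8 := by rw [he]; field_simp
  have he1 : e ≤ 1 / 8 := by
    rw [← heK]; nlinarith [mul_nonneg he0.le (Nat.cast_nonneg K : (0:ℝ) ≤ K), sq_nonneg (K:ℝ), mul_nonneg he0.le (sq_nonneg (K:ℝ))]
  refine ⟨1 + Polynomial.C (e : ℂ) * (Polynomial.X * ∑ k ∈ Finset.range K,
    Polynomial.C ((s : ℂ) ^ (k + 1)) * Polynomial.X ^ k), Real.sqrt (1 - e / 8), ?_, ?_, ?_, ?_⟩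
  · simp [Polynomial.coeff_one]
  · apply Real.sqrt_pos.2; linarith
  · rw [Real.sqrt_lt' one_pos]; linarith
  · intro w hw hwη
    set u : ℂ := s * w with hu
    have hun : ‖u‖ = s := by rw [hu, norm_mul, hw, mul_one, Complex.norm_real, Real.norm_of_nonneg hs0.le]
    have h1u : η / 2 ≤ ‖1 - u‖ := by
      have : (1 - w : ℂ) = (1 - u) + -((1 - s) * w) := by rw [hu]; ring
      have h2 : ‖(1 - w : ℂ)‖ ≤ ‖1 - u‖ + (1 - s) := by
        rw [this]
        refine (norm_add_le _ _).trans (add_le_add le_rfl (le_of_eq ?_))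
        rw [norm_neg, norm_mul, hw, mul_one]
        have : ((1:ℂ) - s) = ((1 - s : ℝ) : ℂ) := by push_cast; ring
        rw [this, Complex.norm_real, Real.norm_of_nonneg (by linarith)]
      linarith
    have h1u0 : (1 - u) ≠ 0 := by
      rw [← norm_pos_iff]; linarith
    set q : ℂ := ∑ k ∈ Finset.range K, u ^ (k + 1) with hq
    have hev : Polynomial.eval w (1 + Polynomial.C (e : ℂ) * (Polynomial.X * ∑ k ∈ Finset.range K,
        Polynomial.C ((s : ℂ) ^ (k + 1)) * Polynomial.X ^ k)) = 1 + e * q := by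
      simp only [Polynomial.eval_add, Polynomial.eval_one, Polynomial.eval_mul, Polynomial.eval_C,
        Polynomial.eval_X, Polynomial.eval_finsetSum, Polynomial.eval_pow, hq, hu]
      congr 2
      rw [Finset.mul_sum]; congr 1; ext k; ring
    rw [hev]
    have hqn : ‖q‖ ≤ K := by
      refine (norm_sum_le _ _).trans ?_
      have : ∀ k ∈ Finset.range K, ‖u ^ (k + 1)‖ ≤ 1 := by
        intro k _; rw [norm_pow, hun]; exact pow_le_one₀ hs0.le hs1.le
      simpa using Finset.sum_le_sum this
    have hqe : q = u / (1 - u) - u ^ (K + 1) / (1 - u) := by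
      rw [div_sub_div_same, eq_div_iff h1u0, hq]
      have := geom_sum_mul_neg u K
      calc (∑ k ∈ Finset.range K, u ^ (k + 1)) * (1 - u)
          = u * ((∑ k ∈ Finset.range K, u ^ k) * (1 - u)) := by
            rw [← mul_assoc, Finset.mul_sum]; congr 2; ext k; ring
        _ = _ := by rw [this]; ring
    have her : ‖u ^ (K + 1) / (1 - u)‖ ≤ 1 / 8 := by
      rw [norm_div, norm_pow, hun]
      refine le_trans ?_ hK
      rw [div_eq_mul_inv]
      gcongr
      rw [show 2 / η = (η / 2)⁻¹ by field_simp]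
      gcongr
    have hre : (u / (1 - u)).re ≤ - (1 / 4) := by
      have hns : Complex.normSq (1 - u) = ‖1 - u‖ ^ 2 := Complex.normSq_eq_norm_sq _
      have hnu : u.re ^ 2 + u.im ^ 2 = s ^ 2 := by
        rw [← hun, ← Complex.normSq_eq_norm_sq, Complex.normSq_apply]; ring
      have hN : Complex.normSq (1 - u) = 1 - 2 * u.re + s ^ 2 := by
        rw [Complex.normSq_apply, ← hnu]; simp; ring
      have hpos : 0 < Complex.normSq (1 - u) := Complex.normSq_pos.2 h1u0
      have hge : η ^ 2 / 4 ≤ Complex.normSq (1 - u) := by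
        rw [hns]; nlinarith
      have : (u / (1 - u)).re = (u.re - s ^ 2) / Complex.normSq (1 - u) := by
        rw [Complex.div_re, ← hnu]; simp; ring
      rw [this, div_le_iff₀ hpos]
      nlinarith
    have hqre : q.re ≤ - (1 / 8) := by
      have h3 := (abs_le.1 (Complex.abs_re_le_norm (u ^ (K + 1) / (1 - u)))).1
      rw [hqe, Complex.sub_re]; linarith
    apply Real.le_sqrt_of_sq_le
    rw [← Complex.normSq_eq_norm_sq, Complex.normSq_apply]
    have hqq : q.re ^ 2 + q.im ^ 2 ≤ ((K:ℝ) + 1) ^ 2 := by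
      have : q.re ^ 2 + q.im ^ 2 = ‖q‖ ^ 2 := by
        rw [← Complex.normSq_eq_norm_sq, Complex.normSq_apply]; ring
      rw [this]
      gcongr; linarith
    simp
    have : e * e * (q.re ^ 2 + q.im ^ 2) ≤ e * (1 / 8) := by
      rw [← heK]
      have := mul_le_mul_of_nonneg_left hqq (mul_nonneg he0.le he0.le)
      nlinarith
    nlinarith


lemma sn_c2 (g : ℝ → ℂ) (hg : ContDiff ℝ 2 g) : (∀ θ, HasDerivAt g (deriv g θ) θ) ∧
    (∀ θ, HasDerivAt (deriv g) (deriv (deriv g) θ) θ) ∧ Continuous (deriv (deriv g)) ∧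
    Continuous (deriv g) := by
  have h1 : ContDiff ℝ 1 (deriv g) := by
    have h2 : ContDiff ℝ (1 + 1) g := by simpa [one_add_one_eq_two] using hg
    exact (contDiff_succ_iff_deriv.1 h2).2.2
  refine ⟨fun θ => (hg.differentiable (by norm_num) θ).hasDerivAt,
    fun θ => (h1.differentiable (by norm_num) θ).hasDerivAt, h1.continuous_deriv le_rfl,
    h1.continuous⟩

lemma sn_per (g : ℝ → ℂ) (h : ∀ θ, g (θ + 2 * Real.pi) = g θ) (θ : ℝ) :
    deriv g (θ + 2 * Real.pi) = deriv g θ := by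
  rw [← deriv_comp_add_const]
  congr 1; ext x; exact h x

lemma sn_per' (t : ℝ) (g : ℝ → ℂ) (h : ∀ θ, g (θ + 2 * Real.pi) = g θ) :
    g (t - Real.pi) = g (t + Real.pi) := by
  rw [← h]; congr 1; ring

lemma sn_bd (t : ℝ) (g : ℝ → ℂ) (h : Continuous g) :
    ∃ L : ℝ, ∀ θ ∈ Icc (t - Real.pi) (t + Real.pi), ‖g θ‖ ≤ L :=
  isCompact_Icc.exists_bound_of_continuousOn h.continuousOn

lemma sn_cf_smooth (t : ℝ) (g : ℝ → ℂ) (hg : ContDiff ℝ 2 g)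
    (h : ∀ θ, g (θ + 2 * Real.pi) = g θ) : ∃ K : ℝ, 0 ≤ K ∧ ∀ n, ‖snCf t g n‖ ≤ K * snW n := by
  obtain ⟨h1, h2, h3, h4⟩ := sn_c2 g hg
  obtain ⟨L1, hL1⟩ := sn_bd t g hg.continuous
  obtain ⟨L2, hL2⟩ := sn_bd t _ h3
  refine ⟨2 * Real.pi * max 0 (max L1 L2), by positivity, fun n => ?_⟩
  refine sn_cf_decay t g _ _ h1 h2 h3 (sn_per' t g h) (sn_per' t _ (sn_per g h)) _ ?_ ?_ n
  · intro θ hθ; exact (hL1 θ hθ).trans (by simp)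
  · intro θ hθ; exact (hL2 θ hθ).trans (by simp)

lemma sn_cf_poly (t : ℝ) (v : ℝ → ℂ) (hv : Continuous v) (R : Polynomial ℂ) (n : ℤ) :
    snCf t (fun θ => v θ * R.eval (Complex.exp (θ * Complex.I))) n =
      ∑ p ∈ Finset.range (R.natDegree + 1), R.coeff p * snCf t v (n + p) := by
  unfold snCf
  simp_rw [← intervalIntegral.integral_const_mul]
  rw [← intervalIntegral.integral_finsetSum]
  · congr 1; ext θ
    rw [Polynomial.eval_eq_sum_range, Finset.mul_sum, Finset.sum_mul]
    congr 1; ext p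
    have : Complex.exp (((n + p : ℤ) : ℂ) * θ * Complex.I) =
        Complex.exp (θ * Complex.I) ^ p * Complex.exp (n * θ * Complex.I) := by
      rw [← Complex.exp_nat_mul, ← Complex.exp_add]; congr 1; push_cast; ring
    rw [this]; ring
  · intro p _
    have := sn_exp_cont (n + p)
    apply Continuous.intervalIntegrable
    fun_prop

set_option maxHeartbeats 1600000 in
lemma sn_unique (t c₂ : ℝ) (hc₂ : c₂ < 1) (φ : ℝ → ℂ) (hφ : ContDiff ℝ 2 φ)
    (hper : ∀ θ, φ (θ + 2 * Real.pi) = φ θ) (hone : ∀ θ, c₂ ≤ Real.cos (θ - t) → φ θ = 1)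
    (d : ℤ → ℂ) (B : ℝ) (hd : ∀ l, ‖d l‖ ≤ B)
    (h0 : ∀ k : ℤ, ∑' l, d l * snCf t φ (l + k) = 0) (J : ℤ) (hJ : ∀ l < J, d l = 0) : d J = 0 := by
  have hB : 0 ≤ B := (norm_nonneg _).trans (hd 0)
  have hpi := Real.pi_pos
  obtain ⟨P, ρ, hP0, hρ0, hρ1, hP⟩ := sn_peak (Real.sqrt (2 * (1 - c₂)))
    (Real.sqrt_pos.2 (by linarith))
  set Q : Polynomial ℂ := P.comp (Polynomial.C (Complex.exp (-(t * Complex.I))) * Polynomial.X) with hQ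
  have hQ0 : Q.coeff 0 = 1 := by
    rw [Polynomial.coeff_zero_eq_eval_zero, hQ, Polynomial.eval_comp]
    simpa [Polynomial.coeff_zero_eq_eval_zero] using hP0
  set p : ℝ → ℂ := fun θ => Q.eval (Complex.exp (θ * Complex.I)) with hp
  have hpn : ∀ θ, Real.cos (θ - t) ≤ c₂ → ‖p θ‖ ≤ ρ := by
    intro θ hθ
    have : p θ = P.eval (Complex.exp (((θ - t : ℝ) : ℂ) * Complex.I)) := by
      simp only [hp, hQ, Polynomial.eval_comp, Polynomial.eval_mul, Polynomial.eval_C,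
        Polynomial.eval_X]
      rw [← Complex.exp_add]; congr 2; push_cast; ring
    rw [this]
    apply hP _ (Complex.norm_exp_ofReal_mul_I _)
    apply Real.sqrt_le_iff.2 ⟨norm_nonneg _, ?_⟩
    rw [← Complex.normSq_eq_norm_sq, Complex.normSq_apply]
    simp only [Complex.sub_re, Complex.sub_im, Complex.one_re, Complex.one_im,
      Complex.exp_ofReal_mul_I_re, Complex.exp_ofReal_mul_I_im]
    nlinarith [Real.sin_sq_add_cos_sq (θ - t)]
  have hpc : ContDiff ℝ 2 p := by
    have h1 : ContDiff ℝ 2 (fun θ : ℝ => Complex.exp (θ * Complex.I)) := by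
      apply ContDiff.cexp
      exact (Complex.ofRealCLM.contDiff).mul contDiff_const
    have : p = fun θ : ℝ => ∑ i ∈ Finset.range (Q.natDegree + 1),
        Q.coeff i * Complex.exp (θ * Complex.I) ^ i := by
      ext θ; simp only [hp]; rw [Polynomial.eval_eq_sum_range]
    rw [this]
    exact ContDiff.sum fun i _ => contDiff_const.mul (h1.pow i)
  have hpp : ∀ θ, p (θ + 2 * Real.pi) = p θ := by
    intro θ
    simp only [hp]; congr 1
    rw [Complex.exp_eq_exp_iff_exists_int]
    exact ⟨1, by push_cast; ring⟩
  set v : ℝ → ℂ := fun θ => 1 - φ θ with hv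
  have hvc : ContDiff ℝ 2 v := contDiff_const.sub hφ
  have hvp : ∀ θ, v (θ + 2 * Real.pi) = v θ := by intro θ; simp [hv, hper]
  have hvz : ∀ θ, c₂ < Real.cos (θ - t) → v =ᶠ[𝓝 θ] fun _ => 0 := by
    intro θ hθ
    have : ContinuousAt (fun θ => Real.cos (θ - t)) θ := by fun_prop
    filter_upwards [this.eventually (lt_mem_nhds hθ)] with x hx
    simp [hv, hone x hx.le]
  obtain ⟨v1, v2, v3, v4⟩ := sn_c2 v hvc
  obtain ⟨p1, p2, p3, p4⟩ := sn_c2 p hpc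
  set v' := deriv v with hv'
  set v'' := deriv v' with hv''
  set p' := deriv p with hp'
  set p'' := deriv p' with hp''
  obtain ⟨L, hL1, hLv, hLv', hLv'', hLp', hLp''⟩ : ∃ L : ℝ, 1 ≤ L ∧
      (∀ θ ∈ Icc (t - Real.pi) (t + Real.pi), ‖v θ‖ ≤ L) ∧
      (∀ θ ∈ Icc (t - Real.pi) (t + Real.pi), ‖v' θ‖ ≤ L) ∧
      (∀ θ ∈ Icc (t - Real.pi) (t + Real.pi), ‖v'' θ‖ ≤ L) ∧
      (∀ θ ∈ Icc (t - Real.pi) (t + Real.pi), ‖p' θ‖ ≤ L) ∧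
      (∀ θ ∈ Icc (t - Real.pi) (t + Real.pi), ‖p'' θ‖ ≤ L) := by
    obtain ⟨L1, h1⟩ := sn_bd t v hvc.continuous
    obtain ⟨L2, h2⟩ := sn_bd t v' v4
    obtain ⟨L3, h3⟩ := sn_bd t v'' v3
    obtain ⟨L4, h4⟩ := sn_bd t p' p4
    obtain ⟨L5, h5⟩ := sn_bd t p'' p3
    exact ⟨max 1 (max L1 (max L2 (max L3 (max L4 L5)))), le_max_left _ _,
      fun θ h => (h1 θ h).trans (by simp), fun θ h => (h2 θ h).trans (by simp),
      fun θ h => (h3 θ h).trans (by simp), fun θ h => (h4 θ h).trans (by simp),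
      fun θ h => (h5 θ h).trans (by simp)⟩
  have hsφ : ∀ k, Summable fun l => d l * snCf t φ (l + k) := by
    intro k
    obtain ⟨K, hK0, hK⟩ := sn_cf_smooth t φ hφ hper
    have hw : Summable fun l => B * (K * snW (l + k)) :=
      ((sn_w_summable.comp_injective (add_left_injective k)).mul_left K).mul_left B
    refine Summable.of_norm_bounded hw (fun l => ?_)
    rw [norm_mul]
    exact mul_le_mul (hd l) (hK _) (norm_nonneg _) hB
  set W := ∑' l, snW l with hW
  -- main estimate
  have main : ∀ N : ℕ, ‖d J‖ ≤ B * W * (5 * L ^ 3 * (((N + 2 : ℕ) : ℝ) ^ 2 * ρ ^ N)) := by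
    intro N
    set ε : ℝ := 5 * L ^ 3 * (((N + 2 : ℕ) : ℝ) ^ 2 * ρ ^ N) with hε
    set u : ℝ → ℂ := fun θ => v θ * p θ ^ (N + 2) with hu
    set u' : ℝ → ℂ := fun θ => v' θ * p θ ^ (N + 2) +
      v θ * (((N + 2 : ℕ) : ℂ) * p θ ^ (N + 1) * p' θ) with hu'
    set u'' : ℝ → ℂ := fun θ => (v'' θ * p θ ^ (N + 2) +
      v' θ * (((N + 2 : ℕ) : ℂ) * p θ ^ (N + 1) * p' θ)) + (v' θ * (((N + 2 : ℕ) : ℂ) * p θ ^ (N + 1) * p' θ) +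
      v θ * (((N + 2 : ℕ) : ℂ) * (((N + 1 : ℕ) : ℂ) * p θ ^ N * p' θ) * p' θ +
        ((N + 2 : ℕ) : ℂ) * p θ ^ (N + 1) * p'' θ)) with hu''
    have du : ∀ θ, HasDerivAt u (u' θ) θ := by
      intro θ
      exact (v1 θ).mul ((p1 θ).pow (N + 2))
    have du' : ∀ θ, HasDerivAt u' (u'' θ) θ := by
      intro θ
      exact ((v2 θ).mul ((p1 θ).pow (N + 2))).add ((v1 θ).mul
        ((((p1 θ).pow (N + 1)).const_mul (((N + 2 : ℕ) : ℂ))).mul (p2 θ)))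
    have cu : Continuous u'' := by
      have := hvc.continuous; have := hpc.continuous
      fun_prop
    have hbd : ∀ θ ∈ Icc (t - Real.pi) (t + Real.pi), ‖u θ‖ ≤ ε ∧ ‖u'' θ‖ ≤ ε := by
      intro θ hθ
      have hεp : 0 ≤ ε := by positivity
      by_cases hcos : c₂ < Real.cos (θ - t)
      · have z0 := hvz θ hcos
        have z1 : v' =ᶠ[𝓝 θ] fun _ => 0 := by
          have := z0.deriv; simpa using this
        have z2 : v'' =ᶠ[𝓝 θ] fun _ => 0 := by
          have := z1.deriv; simpa using this
        have e0 := z0.eq_of_nhds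
        have e1 := z1.eq_of_nhds
        have e2 := z2.eq_of_nhds
        simp only [hu, hu'', e0, e1, e2]
        simpa using hεp
      · have hpρ := hpn θ (not_lt.1 hcos)
        have b0 := hLv θ hθ
        have b1 := hLv' θ hθ
        have b2 := hLv'' θ hθ
        have b3 := hLp' θ hθ
        have b4 := hLp'' θ hθ
        have hpow : ∀ k, N ≤ k → ‖p θ ^ k‖ ≤ ρ ^ N := by
          intro k hk
          rw [norm_pow]
          exact (pow_le_pow_left₀ (norm_nonneg _) hpρ k).trans (pow_le_pow_of_le_one hρ0.le hρ1.le hk)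
        have q0 := hpow N le_rfl
        have q1 := hpow (N + 1) (by omega)
        have q2 := hpow (N + 2) (by omega)
        set x : ℝ := ((N + 2 : ℕ) : ℝ) with hx
        set y : ℝ := ρ ^ N with hy
        have hy0 : 0 < y := by positivity
        have hx1 : 1 ≤ x := by rw [hx]; push_cast; linarith [(Nat.cast_nonneg N : (0:ℝ) ≤ N)]
        have hx2 : ((N + 1 : ℕ) : ℝ) ≤ x := by rw [hx]; push_cast; linarith
        have nx : ‖((N + 2 : ℕ) : ℂ)‖ = x := Complex.norm_natCast _
        have ny : ‖((N + 1 : ℕ) : ℂ)‖ ≤ x := by rw [Complex.norm_natCast]; exact hx2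
        have hx0 : 0 ≤ x := by linarith
        have hL0 : 0 ≤ L := by linarith
        have hx3 : x ≤ x ^ 2 := by nlinarith
        have hx4 : 1 ≤ x ^ 2 := by nlinarith
        have hL2 : L ≤ L ^ 2 := by nlinarith
        have hL3 : L ^ 2 ≤ L ^ 3 := by nlinarith [sq_nonneg L]
        have hL4 : L ≤ L ^ 3 := hL2.trans hL3
        have T1 : L * y ≤ L ^ 3 * (x ^ 2 * y) := by
          calc L * y ≤ L ^ 3 * (1 * y) := by rw [one_mul]; gcongr
            _ ≤ _ := by gcongr
        have T2 : L * (x * y * L) ≤ L ^ 3 * (x ^ 2 * y) := by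
          calc L * (x * y * L) = L ^ 2 * (x * y) := by ring
            _ ≤ _ := by gcongr
        have T3 : L * (x * (x * y * L) * L) = L ^ 3 * (x ^ 2 * y) := by ring
        have hpos : 0 ≤ L ^ 3 * (x ^ 2 * y) := by positivity
        have hεe : ε = 5 * (L ^ 3 * (x ^ 2 * y)) := by rw [hε]; ring
        constructor
        · have : ‖u θ‖ ≤ L * y := by
            simp only [hu, norm_mul]
            exact mul_le_mul b0 q2 (norm_nonneg _) hL0
          linarith
        · have s1 : ‖v'' θ * p θ ^ (N + 2)‖ ≤ L * y := by
            rw [norm_mul]; gcongr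
          have s2 : ‖v' θ * (((N + 2 : ℕ) : ℂ) * p θ ^ (N + 1) * p' θ)‖ ≤ L * (x * y * L) := by
            rw [norm_mul, norm_mul, norm_mul, nx]; gcongr
          have s3 : ‖v θ * (((N + 2 : ℕ) : ℂ) * (((N + 1 : ℕ) : ℂ) * p θ ^ N * p' θ) * p' θ +
              ((N + 2 : ℕ) : ℂ) * p θ ^ (N + 1) * p'' θ)‖ ≤ L * (x * (x * y * L) * L + x * y * L) := by
            rw [norm_mul]
            refine mul_le_mul b0 ?_ (norm_nonneg _) hL0
            refine (norm_add_le _ _).trans (add_le_add ?_ ?_)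
            · rw [norm_mul, norm_mul, norm_mul, norm_mul, nx]; gcongr
            · rw [norm_mul, norm_mul, nx]; gcongr
          have s4 := norm_add₄_le (a := v'' θ * p θ ^ (N + 2))
            (b := v' θ * (((N + 2 : ℕ) : ℂ) * p θ ^ (N + 1) * p' θ))
            (c := v' θ * (((N + 2 : ℕ) : ℂ) * p θ ^ (N + 1) * p' θ))
            (d := v θ * (((N + 2 : ℕ) : ℂ) * (((N + 1 : ℕ) : ℂ) * p θ ^ N * p' θ) * p' θ +
              ((N + 2 : ℕ) : ℂ) * p θ ^ (N + 1) * p'' θ))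
          have s5 : u'' θ = _ := rfl
          rw [add_assoc (v'' θ * p θ ^ (N + 2) + _)] at s4
          rw [s5]
          refine s4.trans ?_
          rw [hεe]
          rw [mul_add L] at s3
          linarith
    have hup : ∀ θ, u (θ + 2 * Real.pi) = u θ := by
      intro θ; simp only [hu, hvp, hpp]
    have hup' : ∀ θ, u' (θ + 2 * Real.pi) = u' θ := by
      intro θ; simp only [hu', hvp, hpp, hv', hp', sn_per v hvp, sn_per p hpp]
    have hcf := sn_cf_decay t u u' u'' du du' cu (sn_per' t u hup) (sn_per' t u' hup') ε
      (fun θ h => (hbd θ h).1) (fun θ h => (hbd θ h).2)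
    set R := Q ^ (N + 2) with hR
    have hR0 : R.coeff 0 = 1 := by
      rw [Polynomial.coeff_zero_eq_eval_zero, hR, Polynomial.eval_pow,
        ← Polynomial.coeff_zero_eq_eval_zero, hQ0, one_pow]
    have hdec : ∀ n, snCf t u n = snCf t (fun θ => (fun _ => 1) θ * R.eval (Complex.exp (θ * Complex.I))) n
        - snCf t (fun θ => φ θ * R.eval (Complex.exp (θ * Complex.I))) n := by
      intro n
      have hEc := sn_exp_cont n
      have hφc := hφ.continuous
      have hRc := R.continuous
      unfold snCf
      rw [← intervalIntegral.integral_sub]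
      · congr 1; ext θ
        simp only [hu, hv, hp, hR, Polynomial.eval_pow]; ring
      · apply Continuous.intervalIntegrable; fun_prop
      · apply Continuous.intervalIntegrable; fun_prop
    have hs1 : HasSum (fun l => d l * snCf t (fun θ => (fun _ => (1:ℂ)) θ *
        R.eval (Complex.exp (θ * Complex.I))) (l - J)) (d J * (2 * Real.pi)) := by
      have hz : ∀ l, l ≠ J → d l * snCf t (fun θ => (fun _ => (1:ℂ)) θ *
        R.eval (Complex.exp (θ * Complex.I))) (l - J) = 0 := by
        intro l hl
        rcases lt_or_gt_of_ne hl with h | h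
        · rw [hJ l h, zero_mul]
        · rw [sn_cf_poly t _ continuous_const, Finset.sum_eq_zero, mul_zero]
          intro i _
          rw [sn_cf_one, if_neg (by omega), mul_zero]
      have := hasSum_single J hz
      convert this using 2
      rw [sn_cf_poly t _ continuous_const, Finset.sum_eq_single 0]
      · rw [sn_cf_one, hR0]; simp
      · intro i _ hi
        rw [sn_cf_one, if_neg (by omega), mul_zero]
      · simp
    have hs2 : HasSum (fun l => d l * snCf t (fun θ => φ θ *
        R.eval (Complex.exp (θ * Complex.I))) (l - J)) 0 := by
      have : ∀ l, d l * snCf t (fun θ => φ θ * R.eval (Complex.exp (θ * Complex.I))) (l - J) =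
          ∑ i ∈ Finset.range (R.natDegree + 1), R.coeff i * (d l * snCf t φ (l + (i - J))) := by
        intro l
        rw [sn_cf_poly t _ hφ.continuous, Finset.mul_sum]
        congr 1; ext i
        rw [show l - J + (i:ℤ) = l + (i - J) by ring]; ring
      simp_rw [this]
      have h2 := hasSum_sum (s := Finset.range (R.natDegree + 1))
        (f := fun i l => R.coeff i * (d l * snCf t φ (l + (i - J)))) (a := fun _ => 0) (by
          intro i _
          have := (hsφ (i - J)).hasSum.mul_left (R.coeff i)
          rwa [h0, mul_zero] at this)
      simpa using h2
    have hs3 := hs1.sub hs2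
    rw [sub_zero] at hs3
    have hwJ : HasSum (fun l => B * (2 * Real.pi * ε) * snW (l - J)) (B * (2 * Real.pi * ε) * W) := by
      refine HasSum.mul_left _ ?_
      exact (Equiv.subRight J).hasSum_iff.2 sn_w_summable.hasSum
    have := hs3.norm_le_of_bounded hwJ (by
      intro l
      rw [← mul_sub, ← hdec, norm_mul, mul_assoc B]
      exact mul_le_mul (hd l) (hcf _) (norm_nonneg _) hB)
    rw [norm_mul, norm_mul, Complex.norm_real, Real.norm_of_nonneg hpi.le] at this
    simp only [Complex.norm_ofNat] at this
    have h2 : ‖d J‖ * (2 * Real.pi) ≤ B * W * ε * (2 * Real.pi) := by linarith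
    exact le_of_mul_le_mul_right h2 (by positivity)
  have hlim : Tendsto (fun N : ℕ => B * W * (5 * L ^ 3 * (((N + 2 : ℕ) : ℝ) ^ 2 * ρ ^ N))) atTop
      (𝓝 0) := by
    have h1 := (tendsto_pow_const_mul_const_pow_of_lt_one 2 hρ0.le hρ1).comp
      (tendsto_add_atTop_nat 2)
    have h2 := (h1.const_mul (B * W * (5 * L ^ 3) * (ρ ^ 2)⁻¹))
    rw [mul_zero] at h2
    refine h2.congr (fun N => ?_)
    simp only [Function.comp]
    rw [pow_add ρ N 2]
    field_simp
  have := ge_of_tendsto' hlim main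
  exact norm_le_zero_iff.1 this


lemma sn_cutoff (t δ : ℝ) (h0 : 0 < δ) (h1 : δ < Real.pi) : ∃ (φ : ℝ → ℝ) (c₂ : ℝ), c₂ < 1 ∧
    ContDiff ℝ 2 φ ∧ (∀ θ, φ (θ + 2 * Real.pi) = φ θ) ∧
    (∀ θ, c₂ ≤ Real.cos (θ - t) → φ θ = 1) ∧ (∀ θ, |φ θ| ≤ 1) ∧
    (∀ θ, |θ - t| ≤ Real.pi → δ ≤ |θ - t| → φ θ = 0) := by
  have hc1 : Real.cos δ < 1 := by
    have := Real.cos_lt_cos_of_nonneg_of_le_pi le_rfl h1.le h0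
    simpa using this
  set c₁ := Real.cos δ with hc
  set c₂ := (c₁ + 1) / 2 with hc2
  have hcc : 0 < c₂ - c₁ := by rw [hc2]; linarith
  refine ⟨fun θ => Real.smoothTransition ((Real.cos (θ - t) - c₁) / (c₂ - c₁)), c₂,
    by rw [hc2]; linarith, ?_, ?_, ?_, ?_, ?_⟩
  · have : ContDiff ℝ 2 (fun θ : ℝ => (Real.cos (θ - t) - c₁) / (c₂ - c₁)) := by
      apply ContDiff.div_const
      exact (Real.contDiff_cos.comp (contDiff_id.sub contDiff_const)).sub contDiff_const
    exact (Real.smoothTransition.contDiff (n := 2)).comp this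
  · intro θ
    simp only
    rw [show θ + 2 * Real.pi - t = (θ - t) + 2 * Real.pi by ring, Real.cos_add_two_pi]
  · intro θ h
    apply Real.smoothTransition.one_of_one_le
    rw [le_div_iff₀ hcc]; linarith
  · intro θ
    rw [abs_of_nonneg (Real.smoothTransition.nonneg _)]
    exact Real.smoothTransition.le_one _
  · intro θ h2 h3
    apply Real.smoothTransition.zero_of_nonpos
    apply div_nonpos_of_nonpos_of_nonneg _ hcc.le
    have := Real.cos_le_cos_of_nonneg_of_le_pi h0.le h2 h3
    rw [Real.cos_abs] at this
    linarith

lemma sn_w_mono (n m : ℕ) : snW ((n : ℤ) + m) ≤ snW n := by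
  unfold snW
  by_cases hn : n = 0
  · subst hn
    by_cases hm : m = 0
    · simp [hm]
    · have : (1:ℝ) ≤ m := by exact_mod_cast Nat.one_le_iff_ne_zero.2 hm
      simp [hm]
      apply inv_le_one_of_one_le₀; nlinarith
  · have h1 : ¬ ((n:ℤ) + m = 0) := by omega
    have h2 : ¬ ((n:ℤ) = 0) := by omega
    have h3 : (0:ℝ) < n := by exact_mod_cast Nat.pos_of_ne_zero hn
    rw [if_neg h1, if_neg h2]
    push_cast
    gcongr
    linarith [(Nat.cast_nonneg m : (0:ℝ) ≤ m)]

lemma sn_ser_cont (a : ℕ → ℂ) (C : ℝ) (hC : ∀ n, ‖a n‖ ≤ C) (r : ℝ) (hr0 : 0 < r) (hr1 : r < 1) :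
    Continuous fun θ : ℝ => ∑' n : ℕ, a n * (r * Complex.exp (θ * Complex.I)) ^ n := by
  refine continuous_tsum (u := fun n => C * r ^ n) (fun n => by fun_prop)
    ((summable_geometric_of_lt_one hr0.le hr1).mul_left C) (fun n θ => ?_)
  rw [norm_mul, norm_pow, norm_mul, Complex.norm_exp_ofReal_mul_I, mul_one, Complex.norm_real,
    Real.norm_of_nonneg hr0.le]
  have := hC n
  gcongr

lemma sn_int_series (a : ℕ → ℂ) (C : ℝ) (hC : ∀ n, ‖a n‖ ≤ C) (r : ℝ) (hr0 : 0 < r) (hr1 : r < 1)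
    (t : ℝ) (φ : ℝ → ℂ) (hφ : Continuous φ) (hφ1 : ∀ θ, ‖φ θ‖ ≤ 1) (m : ℤ) :
    ∫ θ in (t - Real.pi)..(t + Real.pi), Complex.exp (m * θ * Complex.I) *
      (φ θ * ∑' n : ℕ, a n * (r * Complex.exp (θ * Complex.I)) ^ n) =
    ∑' n : ℕ, a n * (r:ℂ) ^ n * snCf t φ (n + m) := by
  have hC0 : 0 ≤ C := (norm_nonneg _).trans (hC 0)
  have hE := sn_exp_cont m
  have nb : ∀ (n : ℕ) (θ : ℝ), ‖a n * (r * Complex.exp (θ * Complex.I)) ^ n‖ ≤ C * r ^ n := by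
    intro n θ
    rw [norm_mul, norm_pow, norm_mul, Complex.norm_exp_ofReal_mul_I, mul_one, Complex.norm_real,
      Real.norm_of_nonneg hr0.le]
    have := hC n
    gcongr
  have hsg : Summable fun n : ℕ => C * r ^ n :=
    (summable_geometric_of_lt_one hr0.le hr1).mul_left C
  have key := intervalIntegral.hasSum_integral_of_dominated_convergence (μ := volume)
    (a := t - Real.pi) (b := t + Real.pi)
    (F := fun (n : ℕ) (θ : ℝ) => Complex.exp (m * θ * Complex.I) *
      (φ θ * (a n * (r * Complex.exp (θ * Complex.I)) ^ n)))
    (f := fun θ : ℝ => Complex.exp (m * θ * Complex.I) *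
      (φ θ * ∑' n : ℕ, a n * (r * Complex.exp (θ * Complex.I)) ^ n))
    (fun n _ => C * r ^ n) (fun n => by
      apply Continuous.aestronglyMeasurable; fun_prop)
    (fun n => by
      filter_upwards with θ _
      rw [norm_mul, norm_mul, sn_exp_norm, one_mul]
      calc _ ≤ 1 * (C * r ^ n) :=
            mul_le_mul (hφ1 θ) (nb n θ) (norm_nonneg _) zero_le_one
        _ = _ := one_mul _)
    (by filter_upwards with θ _ using hsg)
    (by exact intervalIntegrable_const)
    (by
      filter_upwards with θ _
      refine HasSum.mul_left _ (HasSum.mul_left _ ?_)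
      exact (Summable.of_norm_bounded hsg (fun n => nb n θ)).hasSum)
  rw [← key.tsum_eq]
  congr 1; ext n
  unfold snCf
  rw [← intervalIntegral.integral_const_mul]
  congr 1; ext θ
  have : Complex.exp (((n + m : ℤ) : ℂ) * θ * Complex.I) =
      Complex.exp (θ * Complex.I) ^ n * Complex.exp (m * θ * Complex.I) := by
    rw [← Complex.exp_nat_mul, ← Complex.exp_add]; congr 1; push_cast; ring
  rw [this, mul_pow]; ring

/-- The correlation coefficients decay at `-∞`. -/
lemma sn_decay (a : ℕ → ℂ) (C : ℝ) (hC : ∀ n, ‖a n‖ ≤ C) (t : ℝ) (φ : ℝ → ℂ)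
    (hφ : ContDiff ℝ 2 φ) (hφ1 : ∀ θ, ‖φ θ‖ ≤ 1) (hper : ∀ θ, φ (θ + 2 * Real.pi) = φ θ)
    (M : ℝ) (hM : ∀ r : ℝ, 0 < r → r < 1 → ∫ θ in Ioc (t - Real.pi) (t + Real.pi),
      ‖φ θ * ∑' n : ℕ, a n * (r * Complex.exp (θ * Complex.I)) ^ n‖ ≤ M) :
    Tendsto (fun m : ℤ => ∑' n : ℕ, a n * snCf t φ (n + -m)) atTop (𝓝 0) := by
  have hC0 : 0 ≤ C := (norm_nonneg _).trans (hC 0)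
  have hpi := Real.pi_pos
  have : Fact (0 < 2 * Real.pi) := ⟨by positivity⟩
  obtain ⟨K, hK0, hK⟩ := sn_cf_smooth t φ hφ hper
  have hsw : ∀ m : ℤ, Summable fun n : ℕ => C * (K * snW (n + m)) := by
    intro m
    refine Summable.mul_left _ (Summable.mul_left _ ?_)
    have h1 := sn_w_summable.comp_injective (add_left_injective m)
    exact h1.comp_injective (i := fun n : ℕ => (n : ℤ)) Nat.cast_injective
  let r : ℕ → ℝ := fun j => 1 - 1 / ((j : ℝ) + 2)
  have hr0 : ∀ j, 0 < r j := by
    intro j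
    have : 1 / ((j : ℝ) + 2) < 1 := by
      rw [div_lt_one (by positivity)]; linarith [(Nat.cast_nonneg j : (0:ℝ) ≤ j)]
    simp only [r]; linarith
  have hr1 : ∀ j, r j < 1 := by
    intro j
    have : 0 < 1 / ((j : ℝ) + 2) := by positivity
    simp only [r]; linarith
  have hrl : Tendsto r atTop (𝓝 1) := by
    have h1 : Tendsto (fun j : ℕ => 1 / ((j : ℝ) + 2)) atTop (𝓝 0) := by
      have := tendsto_one_div_add_atTop_nhds_zero_nat (𝕜 := ℝ)
      have := this.comp (tendsto_add_atTop_nat 1)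
      refine this.congr (fun j => ?_)
      simp only [Function.comp]; push_cast; congr 1; ring
    have := h1.const_sub 1
    simpa [r] using this
  let F : ℕ → ℝ → ℂ := fun j θ => φ θ * ∑' n : ℕ, a n * (r j * Complex.exp (θ * Complex.I)) ^ n
  have hF : ∀ j, Continuous (F j) := fun j =>
    hφ.continuous.mul (sn_ser_cont a C hC (r j) (hr0 j) (hr1 j))
  let U : Ultrafilter ℕ := Ultrafilter.of atTop
  have hU : (U : Filter ℕ) ≤ atTop := Ultrafilter.of_le _
  obtain ⟨ν, h, hνf, hm, hi, hlim⟩ := sn_cweak (X := AddCircle (2 * Real.pi)) U F hF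
    (t - Real.pi) (t + Real.pi) (fun θ => (θ : AddCircle (2 * Real.pi)))
    (AddCircle.continuous_mk' _) M.toNNReal
    (fun j => (hM (r j) (hr0 j) (hr1 j)).trans (Real.le_coe_toNNReal M))
  have hA : ∀ m : ℤ, ∫ x, fourier m x * h x ∂ν = ∑' n : ℕ, a n * snCf t φ (n + m) := by
    intro m
    have l1 := hlim (fourier m)
    have e1 : ∀ j, ∫ θ in Ioc (t - Real.pi) (t + Real.pi),
        fourier m (θ : AddCircle (2 * Real.pi)) * F j θ =
        ∑' n : ℕ, a n * (r j : ℂ) ^ n * snCf t φ (n + m) := by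
      intro j
      rw [← sn_int_series a C hC (r j) (hr0 j) (hr1 j) t φ hφ.continuous hφ1 m,
        intervalIntegral.integral_of_le (by linarith)]
      congr 1; ext θ
      rw [fourier_coe_apply]
      congr 2
      have : (Real.pi : ℂ) ≠ 0 := by exact_mod_cast hpi.ne'
      push_cast; field_simp
    simp_rw [e1] at l1
    have l2 : Tendsto (fun j => ∑' n : ℕ, a n * (r j : ℂ) ^ n * snCf t φ (n + m)) atTop
        (𝓝 (∑' n : ℕ, a n * snCf t φ (n + m))) := by
      refine tendsto_tsum_of_dominated_convergence (hsw m) (fun n => ?_) ?_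
      · have h1 : Tendsto (fun j => (r j : ℂ)) atTop (𝓝 1) := by
          have := (Complex.continuous_ofReal.tendsto 1).comp hrl
          rw [Complex.ofReal_one] at this
          exact this
        have := ((h1.pow n).const_mul (a n)).mul_const (snCf t φ (n + m))
        simpa using this
      · filter_upwards with j n
        rw [norm_mul, norm_mul, norm_pow, Complex.norm_real, Real.norm_of_nonneg (hr0 j).le]
        have h1 : ‖a n‖ * r j ^ n ≤ C := by
          calc ‖a n‖ * r j ^ n ≤ C * 1 := mul_le_mul (hC n)
                (pow_le_one₀ (hr0 j).le (hr1 j).le) (pow_nonneg (hr0 j).le _) hC0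
            _ = C := mul_one _
        exact mul_le_mul h1 (hK _) (norm_nonneg _) hC0
    exact tendsto_nhds_unique l1 (l2.mono_left hU)
  have hpos : Tendsto (fun m : ℤ => ∫ x, fourier m x * h x ∂ν) atTop (𝓝 0) := by
    simp_rw [hA]
    have : Tendsto (fun m : ℤ => ∑' n : ℕ, a n * snCf t φ (n + m)) atTop (𝓝 (∑' n : ℕ, (0:ℂ))) := by
      have hs0 := hsw 0
      refine tendsto_tsum_of_dominated_convergence hs0 (fun n => ?_) ?_
      · have hw0 : Tendsto (fun m : ℤ => C * (K * snW (n + m))) atTop (𝓝 0) := by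
          have h1 : Tendsto snW atTop (𝓝 0) :=
            sn_w_summable.tendsto_cofinite_zero.mono_left atTop_le_cofinite
          have h2 := h1.comp (tendsto_atTop_add_const_left atTop (n : ℤ) tendsto_id)
          simpa using (h2.const_mul K).const_mul C
        refine squeeze_zero_norm (fun m => ?_) hw0
        rw [norm_mul]
        exact mul_le_mul (hC n) (hK _) (norm_nonneg _) hC0
      · filter_upwards [eventually_ge_atTop 0] with m hm0 n
        rw [norm_mul]
        refine mul_le_mul (hC n) ((hK _).trans ?_) (norm_nonneg _) hC0
        lift m to ℕ using hm0
        have := sn_w_mono n m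
        rw [add_zero]
        gcongr
    simpa using this
  have := sn_rajchman ν h hm hi hpos
  simp_rw [hA] at this
  exact this

lemma sn_right (a : ℕ → ℂ) (C : ℝ) (hC : ∀ n, ‖a n‖ ≤ C) (t : ℝ) (φ : ℝ → ℂ)
    (hφ : ContDiff ℝ 2 φ) (hper : ∀ θ, φ (θ + 2 * Real.pi) = φ θ)
    (hA : Tendsto (fun m : ℤ => ∑' n : ℕ, a n * snCf t φ (n + -m)) atTop (𝓝 0))
    (b : ℤ → ℂ) (N : ℕ → ℕ) (hN : StrictMono N)
    (hb : ∀ k : ℤ, Tendsto (fun j => a (k + N j).toNat) atTop (nhds (b k))) :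
    (∀ k, ‖b k‖ ≤ C) ∧ ∀ k : ℤ, ∑' l : ℤ, b l * snCf t φ (l + k) = 0 := by
  have hC0 : 0 ≤ C := (norm_nonneg _).trans (hC 0)
  obtain ⟨K, hK0, hK⟩ := sn_cf_smooth t φ hφ hper
  have hNt : Tendsto (fun j => (N j : ℤ)) atTop atTop :=
    tendsto_natCast_atTop_atTop.comp hN.tendsto_atTop
  refine ⟨fun k => le_of_tendsto' (hb k).norm (fun j => hC _), fun k => ?_⟩
  have h1 : Tendsto (fun j => ∑' n : ℕ, a n * snCf t φ (n + -((N j : ℤ) - k))) atTop (𝓝 0) :=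
    hA.comp (tendsto_atTop_add_const_right atTop (-k) hNt)
  let G : ℕ → ℤ → ℂ := fun j l => if 0 ≤ l + N j then a (l + N j).toNat else 0
  have e : ∀ j, ∑' n : ℕ, a n * snCf t φ (n + -((N j : ℤ) - k)) =
      ∑' l : ℤ, G j l * snCf t φ (l + k) := by
    intro j
    let g : ℤ → ℂ := fun l => G j l * snCf t φ (l + k)
    have hinj : Function.Injective (fun n : ℕ => (n : ℤ) - N j) := by
      intro x y hxy; simp only at hxy; omega
    have := hinj.tsum_eq (f := g) (by
      intro l hl
      by_cases h0 : 0 ≤ l + N j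
      · exact ⟨(l + N j).toNat, by simp only; omega⟩
      · exfalso; apply hl; simp [g, G, h0])
    rw [← this]
    congr 1; ext n
    simp only [g, G]
    rw [if_pos (by omega)]
    congr 2
    · congr 1; omega
    · ring
  simp_rw [e] at h1
  have h2 : Tendsto (fun j => ∑' l : ℤ, G j l * snCf t φ (l + k)) atTop
      (𝓝 (∑' l : ℤ, b l * snCf t φ (l + k))) := by
    have hs : Summable fun l : ℤ => C * (K * snW (l + k)) :=
      ((sn_w_summable.comp_injective (add_left_injective k)).mul_left K).mul_left C
    refine tendsto_tsum_of_dominated_convergence hs (fun l => ?_) ?_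
    · refine Tendsto.mul_const _ ((hb l).congr' ?_)
      filter_upwards [hNt.eventually (eventually_ge_atTop (-l))] with j hj
      simp only [G]
      rw [if_pos (by omega)]
    · filter_upwards with j l
      rw [norm_mul]
      refine mul_le_mul ?_ (hK _) (norm_nonneg _) hC0
      simp only [G]
      split_ifs
      · exact hC _
      · simpa using hC0
  exact tendsto_nhds_unique h2 h1

lemma sn_cf_conj (t : ℝ) (φ : ℝ → ℝ) (n : ℤ) :
    (starRingEnd ℂ) (snCf t (fun θ => (φ θ : ℂ)) n) = snCf t (fun θ => (φ θ : ℂ)) (-n) := by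
  unfold snCf
  have hpi := Real.pi_pos
  rw [intervalIntegral.integral_of_le (by linarith), intervalIntegral.integral_of_le (by linarith),
    ← integral_conj]
  congr 1; ext θ
  rw [map_mul, Complex.conj_ofReal, ← Complex.exp_conj]
  congr 2
  simp

lemma sn_up (d : ℤ → ℂ) (hstep : ∀ J, (∀ l < J, d l = 0) → d J = 0) (k : ℤ)
    (hk : ∀ j ≤ k, d j = 0) : ∀ l, d l = 0 := by
  have : ∀ n : ℕ, ∀ j ≤ k + n, d j = 0 := by
    intro n
    induction n with
    | zero => simpa using hk
    | succ n ih =>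
      intro j hj
      rcases lt_or_eq_of_le hj with h | h
      · exact ih j (by push_cast at h; omega)
      · apply hstep
        intro l hl
        exact ih l (by push_cast at h; omega)
  intro l
  exact this (l - k).toNat l (by omega)

theorem stmt11 (a : ℕ → ℂ) (C : ℝ) (hC : ∀ n, ‖a n‖ ≤ C)
    (b c : ℤ → ℂ) (hb : IsRightLimit a b) (hc : IsRightLimit a c)
    (hne : b 0 ≠ c 0)
    (htail : (∃ k : ℤ, 0 < k ∧ ∀ j : ℤ, k ≤ j → b j = c j) ∨
             (∃ k : ℤ, k < 0 ∧ ∀ j : ℤ, j ≤ k → b j = c j))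
    (f : ℂ → ℂ) (hf : ∀ z ∈ Metric.ball (0 : ℂ) 1, f z = ∑' n : ℕ, a n * z ^ n) :
    StrongNaturalBoundary f := by
  rintro α β hαβ ⟨M, hM⟩
  have hpi := Real.pi_pos
  set t : ℝ := (α + β) / 2 with ht
  set δ : ℝ := min ((β - α) / 2) (Real.pi / 2) with hδ
  have hδ0 : 0 < δ := lt_min (by linarith) (by linarith)
  have hδ1 : δ < Real.pi := (min_le_right _ _).trans_lt (by linarith)
  have hδ2 : δ ≤ (β - α) / 2 := min_le_left _ _
  obtain ⟨φ, c₂, hc₂, hφs, hφp, hφo, hφb, hφz⟩ := sn_cutoff t δ hδ0 hδ1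
  set Φ : ℝ → ℂ := fun θ => (φ θ : ℂ) with hΦ
  have hΦs : ContDiff ℝ 2 Φ := Complex.ofRealCLM.contDiff.comp hφs
  have hΦp : ∀ θ, Φ (θ + 2 * Real.pi) = Φ θ := fun θ => by simp only [hΦ, hφp]
  have hΦ1 : ∀ θ, ‖Φ θ‖ ≤ 1 := fun θ => by
    simp only [hΦ, Complex.norm_real]; exact hφb θ
  have hΦo : ∀ θ, c₂ ≤ Real.cos (θ - t) → Φ θ = 1 := fun θ h => by
    simp only [hΦ, hφo θ h, Complex.ofReal_one]
  have hfe : ∀ r : ℝ, 0 < r → r < 1 → ∀ θ : ℝ, f (r * Complex.exp (θ * Complex.I)) =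
      ∑' n : ℕ, a n * (r * Complex.exp (θ * Complex.I)) ^ n := by
    intro r h0 h1 θ
    apply hf
    rw [mem_ball_zero_iff, norm_mul, Complex.norm_exp_ofReal_mul_I, mul_one, Complex.norm_real,
      Real.norm_of_nonneg h0.le]
    exact h1
  have hbound : ∀ r : ℝ, 0 < r → r < 1 → ∫ θ in Ioc (t - Real.pi) (t + Real.pi),
      ‖Φ θ * ∑' n : ℕ, a n * (r * Complex.exp (θ * Complex.I)) ^ n‖ ≤ M * (2 * Real.pi) := by
    intro r h0 h1
    have hcont := sn_ser_cont a C hC r h0 h1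
    have h2 := hM r h0 h1
    rw [div_le_iff₀ (by positivity)] at h2
    simp_rw [hfe r h0 h1] at h2
    rw [intervalIntegral.integral_of_le hαβ.le] at h2
    refine le_trans ?_ h2
    set S : ℝ → ℂ := fun θ => ∑' n : ℕ, a n * (r * Complex.exp (θ * Complex.I)) ^ n with hS
    have hSi : IntegrableOn (fun θ => ‖S θ‖) (Ioc α β) :=
      (hcont.norm.integrableOn_Icc).mono_set Ioc_subset_Icc_self
    calc ∫ θ in Ioc (t - Real.pi) (t + Real.pi), ‖Φ θ * S θ‖
        ≤ ∫ θ in Ioc (t - Real.pi) (t + Real.pi), (Ioc α β).indicator (fun θ => ‖S θ‖) θ := by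
          refine setIntegral_mono_on ?_ ?_ measurableSet_Ioc ?_
          · exact ((hΦs.continuous.mul hcont).norm.integrableOn_Icc).mono_set Ioc_subset_Icc_self
          · exact ((integrable_indicator_iff measurableSet_Ioc).2 hSi).integrableOn
          · intro θ hθ
            by_cases hin : θ ∈ Ioc α β
            · rw [indicator_of_mem hin, norm_mul]
              exact mul_le_of_le_one_left (norm_nonneg _) (hΦ1 θ)
            · rw [indicator_of_notMem hin]
              have hz : φ θ = 0 := by
                apply hφz
                · rw [abs_le]; constructor <;> linarith [hθ.1, hθ.2]
                · rw [le_abs]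
                  by_contra hcon
                  push Not at hcon
                  apply hin
                  constructor <;> linarith [hcon.1, hcon.2]
              simp [hΦ, hz]
      _ ≤ ∫ θ, (Ioc α β).indicator (fun θ => ‖S θ‖) θ := by
          refine setIntegral_le_integral ((integrable_indicator_iff measurableSet_Ioc).2 hSi) ?_
          filter_upwards with θ
          exact indicator_nonneg (fun _ _ => norm_nonneg _) θ
      _ = ∫ θ in Ioc α β, ‖S θ‖ := integral_indicator measurableSet_Ioc
  have hA := sn_decay a C hC t Φ hΦs hΦ1 hΦp _ hbound
  obtain ⟨N₁, hN₁, hb'⟩ := hb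
  obtain ⟨N₂, hN₂, hc'⟩ := hc
  obtain ⟨bb, b0⟩ := sn_right a C hC t Φ hΦs hΦp hA b N₁ hN₁ hb'
  obtain ⟨cb, c0⟩ := sn_right a C hC t Φ hΦs hΦp hA c N₂ hN₂ hc'
  obtain ⟨K, hK0, hK⟩ := sn_cf_smooth t Φ hΦs hΦp
  have hC0 : 0 ≤ C := (norm_nonneg _).trans (hC 0)
  have hsum : ∀ (e : ℤ → ℂ), (∀ l, ‖e l‖ ≤ C) → ∀ k, Summable fun l => e l * snCf t Φ (l + k) := by
    intro e he k
    have hs : Summable fun l : ℤ => C * (K * snW (l + k)) :=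
      ((sn_w_summable.comp_injective (add_left_injective k)).mul_left K).mul_left C
    refine Summable.of_norm_bounded hs (fun l => ?_)
    rw [norm_mul]
    exact mul_le_mul (he l) (hK _) (norm_nonneg _) hC0
  set d : ℤ → ℂ := fun l => b l - c l with hd
  have hdb : ∀ l, ‖d l‖ ≤ C + C := fun l => (norm_sub_le _ _).trans (add_le_add (bb l) (cb l))
  have d0 : ∀ k : ℤ, ∑' l, d l * snCf t Φ (l + k) = 0 := by
    intro k
    simp only [hd, sub_mul]
    rw [(hsum b bb k).tsum_sub (hsum c cb k), b0, c0, sub_zero]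
  apply hne
  rw [← sub_eq_zero]
  change d 0 = 0
  rcases htail with ⟨k, _, hk⟩ | ⟨k, _, hk⟩
  · set d' : ℤ → ℂ := fun l => (starRingEnd ℂ) (d (-l)) with hd'
    have hdb' : ∀ l, ‖d' l‖ ≤ C + C := fun l => by
      simp only [hd', RCLike.norm_conj]; exact hdb _
    have d0' : ∀ k : ℤ, ∑' l, d' l * snCf t Φ (l + k) = 0 := by
      intro k
      have h1 := congrArg (starRingEnd ℂ) (d0 (-k))
      rw [map_zero, Complex.conj_tsum, ← (Equiv.neg ℤ).tsum_eq] at h1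
      rw [← h1]
      congr 1; ext l
      simp only [hd', Equiv.neg_apply, map_mul]
      rw [hΦ, sn_cf_conj]
      congr 2; ring
    have := sn_up d' (fun J hJ => sn_unique t c₂ hc₂ Φ hΦs hΦp hΦo d' _ hdb' d0' J hJ) (-k) (by
      intro j hj
      simp only [hd', hd]
      rw [hk (-j) (by omega), sub_self, map_zero]) 0
    simpa [hd'] using this
  · exact sn_up d (fun J hJ => sn_unique t c₂ hc₂ Φ hΦs hΦp hΦo d _ hdb d0 J hJ) k (by
      intro j hj
      simp only [hd]
      rw [hk j hj, sub_self]) 0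
end

section
/- Let b : ℤ → ℂ be a bounded two-sided sequence that is reflectionless on some nonempty open arc I of the unit circle. Suppose there exist constants C, D > 0 such that |b_n| ≤ C e^{-Dn} for all n > 0. Then b_n = 0 for every n ∈ ℤ. -/
open Filter Metric Set MeasureTheory

lemma ps_onBall (c : ℕ → ℂ) (K q : ℝ) (hq : 0 < q) (h : ∀ n, ‖c n‖ ≤ K * q ^ n) :
    HasFPowerSeriesOnBall (fun z : ℂ => ∑' n : ℕ, c n * z ^ n)
      (FormalMultilinearSeries.ofScalars ℂ c) 0 (ENNReal.ofReal q⁻¹) := by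
  have hr : ENNReal.ofReal q⁻¹ ≤ (FormalMultilinearSeries.ofScalars ℂ c).radius := by
    refine FormalMultilinearSeries.le_radius_of_bound _ K (r := Real.toNNReal q⁻¹) ?_
    intro n
    rw [FormalMultilinearSeries.ofScalars_norm, Real.coe_toNNReal _ (by positivity)]
    calc ‖c n‖ * q⁻¹ ^ n ≤ (K * q ^ n) * q⁻¹ ^ n := by gcongr; exact h n
      _ = K := by rw [mul_assoc, ← mul_pow, mul_inv_cancel₀ hq.ne', one_pow, mul_one]
  have hpos : 0 < ENNReal.ofReal q⁻¹ := by
    rw [ENNReal.ofReal_pos]; positivity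
  have h1 := (FormalMultilinearSeries.hasFPowerSeriesOnBall
    (FormalMultilinearSeries.ofScalars ℂ c) (lt_of_lt_of_le hpos hr)).mono hpos hr
  refine h1.congr ?_
  intro z _
  simp [FormalMultilinearSeries.sum, mul_comm]

lemma ps_diff (c : ℕ → ℂ) (K q : ℝ) (hq : 0 < q) (h : ∀ n, ‖c n‖ ≤ K * q ^ n) :
    DifferentiableOn ℂ (fun z : ℂ => ∑' n : ℕ, c n * z ^ n) (ball 0 q⁻¹) := by
  have := (ps_onBall c K q hq h).differentiableOn
  rwa [← Metric.eball_ofReal]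

lemma ps_zero (c : ℕ → ℂ) (K q : ℝ) (hq : 0 < q) (h : ∀ n, ‖c n‖ ≤ K * q ^ n)
    (h0 : ∀ᶠ z in nhdsWithin (0 : ℂ) {0}ᶜ, ∑' n : ℕ, c n * z ^ n = 0) (n : ℕ) : c n = 0 := by
  have h1 := (ps_onBall c K q hq h).hasFPowerSeriesAt
  have h2 := h1.analyticAt.frequently_zero_iff_eventually_zero.1 h0.frequently
  have h3 := (h1.congr (g := 0) h2).eq_zero
  have : (FormalMultilinearSeries.ofScalars ℂ c).coeff n = 0 := by rw [h3]; rfl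
  simpa [FormalMultilinearSeries.coeff_ofScalars] using this

lemma fMinus_eq (b : ℤ → ℂ) (z : ℂ) :
    fMinus b z = z⁻¹ * ∑' n : ℕ, b (-(n : ℤ) - 1) * z⁻¹ ^ n := by
  unfold fMinus
  rw [← tsum_mul_left]
  congr 1; ext n
  have : (-(n : ℤ) - 1) = -((n + 1 : ℕ) : ℤ) := by push_cast; ring
  rw [this, zpow_neg, zpow_natCast, pow_succ, mul_inv, inv_pow]
  ring

lemma arc_nhds (α β : ℝ) (θ : ℝ) (hθ : θ ∈ Ioo α β) :
    (sphere (0 : ℂ) 1 \ arc α β)ᶜ ∈ nhds (Complex.exp (θ * Complex.I)) := by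
  set z₀ := Complex.exp (θ * Complex.I) with hz
  have hz0 : z₀ ≠ 0 := Complex.exp_ne_zero _
  have hn : ‖z₀‖ = 1 := Complex.norm_exp_ofReal_mul_I θ
  have hc : ContinuousAt (fun w : ℂ => θ + Complex.arg (w / z₀)) z₀ := by
    refine continuousAt_const.add (ContinuousAt.comp (g := Complex.arg) ?_ (by fun_prop))
    rw [div_self hz0]
    exact Complex.continuousAt_arg Complex.one_mem_slitPlane
  have := hc.preimage_mem_nhds (t := Ioo α β) (by
    rw [div_self hz0, Complex.arg_one, add_zero]; exact Ioo_mem_nhds hθ.1 hθ.2)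
  filter_upwards [this] with w hw
  rintro ⟨h1, h2⟩
  apply h2
  refine ⟨_, hw, ?_⟩
  have h3 : ‖w / z₀‖ = 1 := by rw [norm_div, hn, div_one]; simpa using h1
  have h4 := Complex.norm_mul_exp_arg_mul_I (w / z₀)
  rw [h3] at h4
  push_cast
  rw [add_mul, Complex.exp_add, ← hz]
  rw [Complex.ofReal_one, one_mul] at h4
  rw [h4]; field_simp

lemma annulus_preconn (D : ℝ) :
    IsPreconnected {z : ℂ | 1 < ‖z‖ ∧ ‖z‖ < Real.exp D} := by
  have : {z : ℂ | 1 < ‖z‖ ∧ ‖z‖ < Real.exp D} = Complex.exp '' (Complex.re ⁻¹' Ioo 0 D) := by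
    ext z
    constructor
    · rintro ⟨h1, h2⟩
      have hp : 0 < ‖z‖ := by linarith
      refine ⟨Complex.log z, ?_, Complex.exp_log (norm_pos_iff.1 hp)⟩
      simp only [mem_preimage, Complex.log_re, mem_Ioo]
      exact ⟨Real.log_pos h1, (Real.log_lt_iff_lt_exp hp).2 h2⟩
    · rintro ⟨w, ⟨h1, h2⟩, rfl⟩
      simp only [mem_ofPred_eq, Complex.norm_exp]
      exact ⟨Real.one_lt_exp_iff.2 h1, Real.exp_lt_exp.2 h2⟩
  rw [this]
  refine IsPreconnected.image ?_ _ Complex.continuous_exp.continuousOn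
  exact ((convex_Ioo 0 D).linear_preimage Complex.reLm).isPreconnected

theorem stmt12 (b : ℤ → ℂ) (A : ℝ) (hb : ∀ n : ℤ, ‖b n‖ ≤ A)
    (α β : ℝ) (hαβ : α < β) (hrefl : Reflectionless b (arc α β))
    (C D : ℝ) (hC : 0 < C) (hD : 0 < D)
    (hdecay : ∀ n : ℤ, 0 < n → ‖b n‖ ≤ C * Real.exp (-D * n)) :
    ∀ n : ℤ, b n = 0 := by
  obtain ⟨g, hg, hgp, hgm⟩ := hrefl
  have hA : 0 ≤ A := (norm_nonneg _).trans (hb 0)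
  have hbp : ∀ n : ℕ, ‖b n‖ ≤ (C + A) * Real.exp (-D) ^ n := by
    intro n
    rcases Nat.eq_zero_or_pos n with rfl | hn
    · have := hb ((0 : ℕ) : ℤ)
      rw [pow_zero, mul_one]; linarith
    · refine (hdecay n (by exact_mod_cast hn)).trans ?_
      rw [← Real.exp_nat_mul]
      have : -D * ((n : ℤ) : ℝ) = n * -D := by push_cast; ring
      rw [this]
      gcongr; linarith
  have hbm : ∀ n : ℕ, ‖b (-(n : ℤ) - 1)‖ ≤ A * (1 : ℝ) ^ n := by
    intro n; simpa using hb _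
  have hR : 1 < Real.exp D := Real.one_lt_exp_iff.2 hD
  have hF : DifferentiableOn ℂ (fPlus b) (ball 0 (Real.exp D)) := by
    have := ps_diff (fun n => b n) _ _ (Real.exp_pos _) hbp
    rwa [← Real.exp_neg, neg_neg] at this
  have hG : DifferentiableOn ℂ (fun z : ℂ => ∑' n : ℕ, b (-(n : ℤ) - 1) * z ^ n) (ball 0 1) := by
    have := ps_diff (fun n : ℕ => b (-(n : ℤ) - 1)) _ _ one_pos hbm
    rwa [inv_one] at this
  have hM : DifferentiableOn ℂ (fMinus b) {z | 1 < ‖z‖} := by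
    have hne : ∀ z ∈ {z : ℂ | 1 < ‖z‖}, z ≠ 0 := by
      intro z hz h; rw [h] at hz; simp at hz; linarith
    have h1 : DifferentiableOn ℂ (fun z : ℂ => z⁻¹) {z : ℂ | 1 < ‖z‖} :=
      differentiableOn_inv.mono (fun z hz => hne z hz)
    refine (h1.mul (hG.comp h1 ?_)).congr ?_
    · intro z hz
      rw [mem_ball_zero_iff, norm_inv]
      exact inv_lt_one_of_one_lt₀ hz
    · intro z _
      exact fMinus_eq b z
  have hopen : IsOpen {z : ℂ | 1 < ‖z‖} := isOpen_lt continuous_const continuous_norm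
  -- local agreement near the arc
  obtain ⟨θ, hθ1, hθ2⟩ := exists_between hαβ
  set z₀ := Complex.exp (θ * Complex.I) with hz₀
  have hn : ‖z₀‖ = 1 := Complex.norm_exp_ofReal_mul_I θ
  have hz₀0 : z₀ ≠ 0 := Complex.exp_ne_zero _
  obtain ⟨r, hr, hrb⟩ := Metric.mem_nhds_iff.1 (inter_mem (arc_nhds α β θ ⟨hθ1, hθ2⟩)
    (isOpen_ball.mem_nhds (show z₀ ∈ ball (0 : ℂ) (Real.exp D) by simpa [hn] using hD)))
  have hclose : ∀ t : ℝ, |t - 1| < r → (t : ℂ) * z₀ ∈ ball z₀ r := by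
    intro t ht
    rw [mem_ball, dist_eq_norm]
    have : (t : ℂ) * z₀ - z₀ = ((t - 1 : ℝ) : ℂ) * z₀ := by push_cast; ring
    rw [this, norm_mul, hn, mul_one, Complex.norm_real]; exact ht
  have hnt : ∀ t : ℝ, 0 ≤ t → ‖(t : ℂ) * z₀‖ = t := by
    intro t ht
    rw [norm_mul, hn, mul_one, Complex.norm_real, Real.norm_of_nonneg ht]
  have hgF : EqOn g (fPlus b) (ball z₀ r) := by
    have a1 : AnalyticOnNhd ℂ g (ball z₀ r) :=
      (hg.mono (fun z hz => (hrb hz).1)).analyticOnNhd isOpen_ball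
    have a2 : AnalyticOnNhd ℂ (fPlus b) (ball z₀ r) :=
      (hF.mono (fun z hz => (hrb hz).2)).analyticOnNhd isOpen_ball
    have hm : 0 < min (r / 2) (1 / 2) := by positivity
    have hm1 := min_le_left (r / 2) (1 / 2)
    have hm2 := min_le_right (r / 2) (1 / 2)
    set m := min (r / 2) (1 / 2)
    have hin : ((1 - m : ℝ) : ℂ) * z₀ ∈ ball z₀ r := by
      apply hclose; rw [abs_lt]; constructor <;> linarith
    refine a1.eqOn_of_preconnected_of_eventuallyEq a2 (convex_ball z₀ r).isPreconnected hin ?_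
    filter_upwards [isOpen_ball.mem_nhds (show ((1 - m : ℝ) : ℂ) * z₀ ∈ ball (0 : ℂ) 1 by
      rw [mem_ball_zero_iff, hnt _ (by linarith)]; linarith)] with z hz
    exact hgp z hz
  have hann : EqOn (fPlus b) (fun z => - fMinus b z) {z : ℂ | 1 < ‖z‖ ∧ ‖z‖ < Real.exp D} := by
    have ho : IsOpen {z : ℂ | 1 < ‖z‖ ∧ ‖z‖ < Real.exp D} :=
      hopen.inter (isOpen_lt continuous_norm continuous_const)
    have a1 : AnalyticOnNhd ℂ (fPlus b) {z : ℂ | 1 < ‖z‖ ∧ ‖z‖ < Real.exp D} :=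
      (hF.mono (fun z hz => by simpa using hz.2)).analyticOnNhd ho
    have a2 : AnalyticOnNhd ℂ (fun z => - fMinus b z) {z : ℂ | 1 < ‖z‖ ∧ ‖z‖ < Real.exp D} :=
      (hM.neg.mono (fun z hz => hz.1)).analyticOnNhd ho
    have hin : ((1 + r / 2 : ℝ) : ℂ) * z₀ ∈ ball z₀ r := by
      apply hclose; rw [abs_lt]; constructor <;> linarith
    have h1 : 1 < ‖((1 + r / 2 : ℝ) : ℂ) * z₀‖ := by
      rw [hnt _ (by linarith)]; linarith
    refine a1.eqOn_of_preconnected_of_eventuallyEq a2 (annulus_preconn D)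
      ⟨h1, by simpa using (hrb hin).2⟩ ?_
    filter_upwards [isOpen_ball.mem_nhds hin, hopen.mem_nhds h1] with z hz hz1
    rw [← hgF hz, hgm z hz1]
  -- the glued entire function
  classical
  set H : ℂ → ℂ := fun z => if ‖z‖ < Real.exp D then fPlus b z else - fMinus b z with hH
  have hH1 : ∀ z : ℂ, ‖z‖ < Real.exp D → H z = fPlus b z := fun z hz => if_pos hz
  have hH2 : ∀ z : ℂ, 1 < ‖z‖ → H z = - fMinus b z := by
    intro z hz
    by_cases h : ‖z‖ < Real.exp D
    · rw [hH1 z h]; exact hann ⟨hz, h⟩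
    · exact if_neg h
  have hHd : Differentiable ℂ H := by
    intro z
    by_cases h : ‖z‖ < Real.exp D
    · have hz : ball (0 : ℂ) (Real.exp D) ∈ nhds z := isOpen_ball.mem_nhds (by simpa using h)
      refine (hF.differentiableAt hz).congr_of_eventuallyEq ?_
      filter_upwards [hz] with w hw
      exact hH1 w (by simpa using hw)
    · have hz := hopen.mem_nhds (show z ∈ {z : ℂ | 1 < ‖z‖} from hR.trans_le (not_lt.1 h))
      refine (hM.neg.differentiableAt hz).congr_of_eventuallyEq ?_
      filter_upwards [hz] with w hw
      exact hH2 w hw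
  have hlim : Tendsto H (cocompact ℂ) (nhds 0) := by
    have hi : Tendsto (fun z : ℂ => z⁻¹) (cocompact ℂ) (nhds 0) := by
      rw [← Metric.cobounded_eq_cocompact]; exact tendsto_inv₀_cobounded
    have hGc := (hG.differentiableAt (isOpen_ball.mem_nhds
      (mem_ball_self one_pos : (0 : ℂ) ∈ ball 0 1))).continuousAt.tendsto.comp hi
    have := (hi.mul hGc).neg
    rw [zero_mul, neg_zero] at this
    refine this.congr' ?_
    filter_upwards [tendsto_norm_cocompact_atTop.eventually_gt_atTop 1] with z hz
    rw [hH2 z hz, fMinus_eq]; rfl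
  have hH0 : ∀ z, H z = 0 := fun z => hHd.apply_eq_of_tendsto_cocompact z hlim
  have hP : ∀ n : ℕ, b n = 0 := by
    refine ps_zero (fun n => b n) _ _ (Real.exp_pos _) hbp ?_
    refine eventually_nhdsWithin_of_eventually_nhds ?_
    filter_upwards [ball_mem_nhds (0 : ℂ) (Real.exp_pos D)] with z hz
    have := hH1 z (by simpa using hz)
    rw [hH0] at this
    exact this.symm
  have hN : ∀ n : ℕ, b (-(n : ℤ) - 1) = 0 := by
    refine ps_zero (fun n : ℕ => b (-(n : ℤ) - 1)) _ _ one_pos hbm ?_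
    filter_upwards [self_mem_nhdsWithin, mem_nhdsWithin_of_mem_nhds
      (ball_mem_nhds (0 : ℂ) one_pos)] with z hz0 hz
    have hz0 : z ≠ 0 := hz0
    have hz1 : 1 < ‖z⁻¹‖ := by
      rw [norm_inv]
      exact (one_lt_inv₀ (norm_pos_iff.2 hz0)).2 (by simpa using hz)
    have := hH2 _ hz1
    rw [hH0, fMinus_eq, inv_inv] at this
    have h2 := neg_eq_zero.1 this.symm
    exact (mul_eq_zero.1 h2).resolve_left hz0
  intro n
  rcases lt_or_ge n 0 with h | h
  · obtain ⟨k, hk⟩ := Int.eq_ofNat_of_zero_le (show 0 ≤ -n - 1 by omega)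
    have := hN k
    rwa [show -(k : ℤ) - 1 = n by omega] at this
  · obtain ⟨k, rfl⟩ := Int.eq_ofNat_of_zero_le h
    exact hP k
end
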